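/- arXiv:math/9811014 — 2 statements merged into one kernel-verified Lean document; each statement's English description precedes it below -/
import Mathlib

section
/- Let n ≥ 1 and let f : ℝ^{2n} → ℝ be a smooth proper function (preimages of compact sets are compact). Then the set of values c ∈ range(f) such that the level set f^{-1}(c) carries no periodic orbit of the Hamiltonian vector field X_f has Lebesgue measure zero: for almost every c in the range of f there exists a nonconstant periodic curve γ : ℝ → ℝ^{2n} with γ'(t) = i∇f(γ(t)) and f(γ(t)) = c for all t. (Hofer–Zehnder–Struwe almost-existence theorem in ℝ^{2n}.) -/
section

open Set Metric MeasureTheory Topology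

/-- The values at finitely many nodes determine the value at `1` of `det (1 + t A)`, with weights
independent of `A`. -/
theorem exists_weights_det_one_add_smul {W : Type*} [NormedAddCommGroup W] [NormedSpace ℝ W]
    [FiniteDimensional ℝ W] {t₀ : ℝ} (ht₀ : 0 < t₀) :
    ∃ (s : Finset ℝ) (w : ℝ → ℝ), (∀ t ∈ s, t ∈ Icc 0 t₀) ∧ ∑ t ∈ s, w t = 1 ∧
      ∀ A : W →L[ℝ] W, (1 + A).det = ∑ t ∈ s, w t * (1 + t • A).det := by
  classical
  obtain ⟨s, hs, hcard⟩ := (Icc_infinite ht₀).exists_subset_card_eq (Module.finrank ℝ W + 1)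
  have key : ∀ p : Polynomial ℝ, p.natDegree ≤ Module.finrank ℝ W →
      p.eval 1 = ∑ t ∈ s, (Lagrange.basis s id t).eval 1 * p.eval t := by
    intro p hp
    have h := Lagrange.eq_interpolate (s := s) (v := (id : ℝ → ℝ)) (f := p)
      (fun _ _ _ _ h => h) (by
        rw [hcard]
        exact lt_of_le_of_lt Polynomial.degree_le_natDegree
          (by exact_mod_cast Nat.lt_succ_of_le hp))
    conv_lhs => rw [h]
    rw [Lagrange.interpolate_apply, Polynomial.eval_finsetSum]
    refine Finset.sum_congr rfl fun t _ => ?_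
    simp [mul_comm]
  refine ⟨s, fun t => (Lagrange.basis s id t).eval 1, fun t ht => hs ht, ?_, fun A => ?_⟩
  · simpa using (key 1 (by simp)).symm
  · let b := Module.finBasis ℝ W
    let M := LinearMap.toMatrix b b (A : W →ₗ[ℝ] W)
    let p : Polynomial ℝ := Matrix.det
      ((Polynomial.X : Polynomial ℝ) • M.map Polynomial.C + (1 : Matrix _ _ ℝ).map Polynomial.C)
    have hp : ∀ t : ℝ, p.eval t = (1 + t • A).det := by
      intro t
      have h1 : p.eval t = Matrix.det (t • M + 1) := by
        change Polynomial.evalRingHom t _ = _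
        rw [RingHom.map_det]
        congr 1
        ext i j
        by_cases hij : i = j <;> simp [hij, mul_comm t]
      rw [h1, ContinuousLinearMap.det, ← LinearMap.det_toMatrix b]
      congr 1
      have : ((1 + t • A : W →L[ℝ] W) : W →ₗ[ℝ] W) = LinearMap.id + t • (A : W →ₗ[ℝ] W) := rfl
      rw [this, map_add, map_smul, LinearMap.toMatrix_id, add_comm]
    have h := key p ((Polynomial.natDegree_det_X_add_C_le _ _).trans (by simp))
    simp only [hp] at h
    simpa using h

theorem lipschitzWith_indicator_closedBall {W : Type*} [NormedAddCommGroup W]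
    [InnerProductSpace ℝ W] {u : W → W} {R : ℝ} {K : NNReal}
    (hu : LipschitzOnWith K u (closedBall 0 R)) (h0 : ∀ x, ‖x‖ = R → u x = 0) :
    LipschitzWith K ((closedBall (0 : W) R).indicator u) := by
  have main : ∀ x y, ‖x‖ ≤ R → R < ‖y‖ → ‖u x‖ ≤ K * ‖x - y‖ := by
    intro x y hx hy
    obtain ⟨s, hs, hsR⟩ : ∃ s ∈ Icc (0 : ℝ) 1, ‖x + s • (y - x)‖ = R := by
      have hc : ContinuousOn (fun s : ℝ => ‖x + s • (y - x)‖) (Icc 0 1) := by fun_prop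
      have := intermediate_value_Icc zero_le_one hc
      exact this ⟨by simpa using hx, by simpa using hy.le⟩
    have h1 := hu.norm_sub_le (x := x) (y := x + s • (y - x)) (by simpa using hx)
      (by simp [hsR])
    rw [h0 _ hsR, sub_zero] at h1
    refine h1.trans (mul_le_mul_of_nonneg_left ?_ K.2)
    have : x - (x + s • (y - x)) = s • (x - y) := by module
    rw [this, norm_smul, Real.norm_of_nonneg hs.1]
    exact mul_le_of_le_one_left (norm_nonneg _) hs.2
  refine LipschitzWith.of_dist_le_mul fun x y => ?_
  rw [dist_eq_norm, dist_eq_norm]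
  by_cases hx : ‖x‖ ≤ R <;> by_cases hy : ‖y‖ ≤ R
  · rw [indicator_of_mem (by simpa using hx), indicator_of_mem (by simpa using hy)]
    exact hu.norm_sub_le (by simpa using hx) (by simpa using hy)
  · rw [indicator_of_mem (by simpa using hx), indicator_of_notMem (by simpa using hy), sub_zero]
    exact main x y hx (not_le.1 hy)
  · rw [indicator_of_notMem (by simpa using hx), indicator_of_mem (by simpa using hy), zero_sub,
      norm_neg, norm_sub_rev]
    exact main y x hy (not_le.1 hx)
  · rw [indicator_of_notMem (by simpa using hx), indicator_of_notMem (by simpa using hy)]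
    simp; positivity

variable {W : Type*} [NormedAddCommGroup W] [InnerProductSpace ℝ W]
    [FiniteDimensional ℝ W]

theorem bijective_add_smul_of_lipschitz {v : W → W} {K : NNReal} (hv : LipschitzWith K v)
    {t : ℝ} (ht : 0 ≤ t) (htK : t * K < 1) : Function.Bijective (fun x => x + t • v x) := by
  constructor
  · intro x y hxy
    simp only at hxy
    have h1 : x - y = t • (v y - v x) := by
      rw [smul_sub, sub_eq_sub_iff_add_eq_add, hxy, add_comm]
    have h2 : ‖x - y‖ ≤ t * K * ‖x - y‖ := by
      calc ‖x - y‖ = t * ‖v y - v x‖ := by rw [h1, norm_smul, Real.norm_of_nonneg ht]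
        _ ≤ t * (K * ‖y - x‖) := by gcongr; exact hv.norm_sub_le _ _
        _ = _ := by rw [norm_sub_rev y x]; ring
    have h3 : ‖x - y‖ = 0 := by
      by_contra hne
      have := (norm_nonneg (x - y)).lt_of_ne' hne
      nlinarith
    exact sub_eq_zero.1 (norm_eq_zero.1 h3)
  · intro y
    have hc : ContractingWith (⟨t, ht⟩ * K) (fun x => y - t • v x) := by
      refine ⟨by exact_mod_cast htK, LipschitzWith.of_dist_le_mul fun a b => ?_⟩
      rw [dist_eq_norm, dist_eq_norm]
      calc ‖y - t • v a - (y - t • v b)‖ = t * ‖v b - v a‖ := by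
            rw [← Real.norm_of_nonneg ht, ← norm_smul, Real.norm_of_nonneg ht]; congr 1; module
        _ ≤ t * (K * ‖b - a‖) := by gcongr; exact hv.norm_sub_le _ _
        _ = _ := by rw [norm_sub_rev b a, ← mul_assoc]; rfl
    have : y - t • v hc.fixedPoint = hc.fixedPoint := hc.fixedPoint_isFixedPt
    exact ⟨hc.fixedPoint, (sub_eq_iff_eq_add.1 this).symm⟩

theorem exists_integral_det_one_add_smul_eq [MeasurableSpace W] [BorelSpace W]
    {u : W → W} (hu : ContDiff ℝ 1 u) {R : ℝ}
    (h0 : ∀ x, ‖x‖ = R → u x = 0) :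
    ∃ t₀ > 0, ∀ t ∈ Icc (0 : ℝ) t₀,
      ∫ x in closedBall (0 : W) R, (1 + t • fderiv ℝ u x).det =
        (volume (closedBall (0 : W) R)).toReal := by
  have hD : IsCompact (closedBall (0 : W) R) := isCompact_closedBall _ _
  have hfu : Continuous (fderiv ℝ u) := hu.continuous_fderiv one_ne_zero
  obtain ⟨K, hK⟩ : ∃ K : NNReal, LipschitzOnWith K u (closedBall 0 R) := by
    obtain ⟨C, hC⟩ := hD.exists_bound_of_continuousOn (f := fderiv ℝ u) hfu.continuousOn
    refine ⟨C.toNNReal, Convex.lipschitzOnWith_of_nnnorm_fderiv_le (𝕜 := ℝ)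
      (fun x _ => hu.differentiable one_ne_zero x) (fun x hx => ?_) (convex_closedBall 0 R)⟩
    rw [← NNReal.coe_le_coe, coe_nnnorm]
    exact (hC x hx).trans (Real.le_coe_toNNReal C)
  have hdet : Continuous fun p : ℝ × W => (1 + p.1 • fderiv ℝ u p.2).det := by
    refine ContinuousLinearMap.continuous_det.comp ?_
    fun_prop
  have hpos : ∀ᶠ t in 𝓝 (0 : ℝ), ∀ x ∈ closedBall (0 : W) R, 0 < (1 + t • fderiv ℝ u x).det := by
    refine hD.eventually_forall_of_forall_eventually fun x _ => ?_
    have : (0 : ℝ) < (1 + (0 : ℝ) • fderiv ℝ u x).det := by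
      simp [ContinuousLinearMap.det]
    exact Filter.Tendsto.eventually_const_lt this (hdet.tendsto (0, x))
  have hsmall : ∀ᶠ t : ℝ in 𝓝 (0 : ℝ), t * K < 1 :=
    Filter.Tendsto.eventually_lt_const (by simp)
      ((by fun_prop : Continuous fun t : ℝ => t * (K : ℝ)).tendsto 0)
  obtain ⟨ε, hε, hεt⟩ := Metric.eventually_nhds_iff.1 (hpos.and hsmall)
  refine ⟨ε / 2, by positivity, fun t ht => ?_⟩
  have ht' := hεt (y := t) (by
    rw [Real.dist_eq, sub_zero, abs_of_nonneg ht.1]; linarith [ht.2])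
  set v := (closedBall (0 : W) R).indicator u
  have hbij := bijective_add_smul_of_lipschitz (lipschitzWith_indicator_closedBall hK h0)
    ht.1 ht'.2
  have heq : EqOn (fun x => x + t • u x) (fun x => x + t • v x) (closedBall 0 R) := by
    intro x hx
    simp only [v, indicator_of_mem hx]
  have hout : ∀ x, x ∉ closedBall (0 : W) R → x + t • v x = x := by
    intro x hx
    simp only [v, indicator_of_notMem hx, smul_zero, add_zero]
  have himg : (fun x => x + t • u x) '' closedBall 0 R = closedBall 0 R := by
    rw [heq.image_eq]
    ext y
    constructor
    · rintro ⟨x, hx, rfl⟩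
      by_contra hy
      have := hbij.1 (hout _ hy)
      exact hy (by simp only at this ⊢; rw [this]; exact hx)
    · intro hy
      obtain ⟨x, rfl⟩ := hbij.2 y
      refine ⟨x, ?_, rfl⟩
      by_contra hx
      have hy' : x + t • v x ∈ closedBall (0 : W) R := hy
      rw [hout x hx] at hy'
      exact hx hy'
  have hder : ∀ x ∈ closedBall (0 : W) R, HasFDerivWithinAt (fun x => x + t • u x)
      (1 + t • fderiv ℝ u x) (closedBall 0 R) x := fun x _ =>
    ((hasFDerivAt_id x).add
      ((hu.differentiable one_ne_zero x).hasFDerivAt.const_smul t)).hasFDerivWithinAt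
  have hvol := lintegral_abs_det_fderiv_eq_addHaar_image volume
    measurableSet_closedBall hder ((hbij.1.injOn).congr heq.symm)
  rw [himg] at hvol
  rw [← hvol, integral_eq_lintegral_of_nonneg_ae]
  · congr 1
    refine setLIntegral_congr_fun measurableSet_closedBall fun x hx => ?_
    simp only [abs_of_pos (ht'.1 x hx)]
  · exact (ae_restrict_iff' measurableSet_closedBall).2
      (Filter.Eventually.of_forall fun x hx => (ht'.1 x hx).le)
  · exact (hdet.comp (by fun_prop : Continuous fun x : W => (t, x))).aestronglyMeasurable

/-- There is no `C¹` retraction of a ball onto its boundary sphere. -/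
theorem no_contDiff_retraction {r : W → W} (hr : ContDiff ℝ 1 r) {R : ℝ} (hR : 0 < R)
    (hid : ∀ x, ‖x‖ = R → r x = x) (hsph : ∀ x, ‖r x‖ = R) : False := by
  let _ : MeasurableSpace W := borel W
  have : BorelSpace W := ⟨rfl⟩
  set u : W → W := fun x => r x - x
  have hu : ContDiff ℝ 1 u := hr.sub contDiff_id
  obtain ⟨t₀, ht₀, hInt⟩ := exists_integral_det_one_add_smul_eq hu (R := R)
    (fun x hx => by simp [u, hid x hx])
  obtain ⟨s, w, hs, hw, hdet⟩ := exists_weights_det_one_add_smul (W := W) ht₀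
  have hzero : ∀ x, (1 + fderiv ℝ u x).det = 0 := by
    intro x
    have h1 : (1 : W →L[ℝ] W) + fderiv ℝ u x = fderiv ℝ r x := by
      have : fderiv ℝ u x = fderiv ℝ r x - fderiv ℝ id x :=
        fderiv_sub (hr.differentiable one_ne_zero x) differentiableAt_id
      rw [this, fderiv_id]
      exact add_sub_cancel _ _
    rw [h1]
    by_contra hne
    have horth : ∀ y, inner ℝ (r x) (fderiv ℝ r x y) = 0 := by
      intro y
      have hd := (hr.differentiable one_ne_zero x).hasFDerivAt
      have h2 := hd.inner ℝ hd
      have h3 : (fun z => inner ℝ (r z) (r z)) = fun _ => R ^ 2 := by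
        ext z; rw [real_inner_self_eq_norm_sq, hsph]
      rw [h3] at h2
      have h4 := congrArg (fun L => L y) (h2.unique (hasFDerivAt_const _ _))
      simp [real_inner_comm] at h4
      exact h4
    have hsurj : Function.Surjective (fderiv ℝ r x) := by
      have := LinearMap.isUnit_iff_isUnit_det (fderiv ℝ r x : W →ₗ[ℝ] W)
      exact ((Module.End.isUnit_iff _).1 (this.2 (isUnit_iff_ne_zero.2 hne))).2
    obtain ⟨y, hy⟩ := hsurj (r x)
    have := horth y
    rw [hy, real_inner_self_eq_norm_sq, hsph] at this
    exact (pow_pos hR 2).ne' this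
  have hfu : Continuous (fderiv ℝ u) := hu.continuous_fderiv one_ne_zero
  have hsum : ∫ x in closedBall (0 : W) R, (1 + fderiv ℝ u x).det =
      (volume (closedBall (0 : W) R)).toReal := by
    rw [funext fun x => hdet (fderiv ℝ u x), integral_finsetSum]
    · simp_rw [integral_const_mul]
      rw [Finset.sum_congr rfl fun t ht => by rw [hInt t (hs t ht)], ← Finset.sum_mul, hw, one_mul]
    · intro t _
      refine Integrable.const_mul ?_ _
      refine ContinuousOn.integrableOn_compact (isCompact_closedBall _ _)
        (Continuous.continuousOn ?_)
      exact ContinuousLinearMap.continuous_det.comp (by fun_prop)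
  simp_rw [hzero] at hsum
  rw [integral_zero] at hsum
  exact (ENNReal.toReal_pos (measure_closedBall_pos volume 0 hR).ne'
    measure_closedBall_lt_top.ne).ne hsum

/-- A continuous self-map of a finite-dimensional space that is the identity outside a bounded
set is onto. -/
theorem surjective_of_eq_id_outside_ball {F : Type*} [NormedAddCommGroup F] [NormedSpace ℝ F]
    [FiniteDimensional ℝ F] {g : F → F} (hg : Continuous g) {ρ : ℝ}
    (hid : ∀ x, ρ ≤ ‖x‖ → g x = x) : Function.Surjective g := by
  intro p
  by_contra! hp
  let Λ := toEuclidean (E := F)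
  let g' : EuclideanSpace ℝ (Fin (Module.finrank ℝ F)) →
      EuclideanSpace ℝ (Fin (Module.finrank ℝ F)) :=
    fun x => Λ (g (Λ.symm x + p) - p)
  have hg' : Continuous g' := by fun_prop
  obtain ⟨ρ', hρ'0, hρ'⟩ : ∃ ρ' > 0, ∀ x, ρ' ≤ ‖x‖ → g' x = x := by
    have hb : Bornology.IsBounded ((fun y => Λ (y - p)) '' closedBall 0 ρ) :=
      ((isCompact_closedBall _ _).image (by fun_prop)).isBounded
    obtain ⟨C, hC0, hC⟩ := hb.exists_pos_norm_lt
    refine ⟨C, hC0, fun x hx => ?_⟩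
    have : ρ ≤ ‖Λ.symm x + p‖ := by
      by_contra! h
      have := hC x ⟨Λ.symm x + p, by simpa using h.le, by simp⟩
      linarith
    simp [g', hid _ this]
  have hne : ∀ x, g' x ≠ 0 := by
    intro x hx
    have : g (Λ.symm x + p) - p = 0 := Λ.map_eq_zero_iff.1 hx
    exact hp _ (sub_eq_zero.1 this)
  obtain ⟨G, hGs, hGd, hGeq, -⟩ := hg'.exists_contDiff_approx_and_eqOn 1 (ε := fun x => ‖g' x‖)
    (hg'.norm) (fun x => norm_pos_iff.2 (hne x)) (S := {x | ρ' + 1 ≤ ‖x‖}) (U := {x | ρ' < ‖x‖})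
    (isClosed_le continuous_const continuous_norm)
    ((isOpen_lt continuous_const continuous_norm).mem_nhdsSet.2 fun x hx => by
      simp only [mem_ofPred_eq] at hx ⊢; linarith)
    (contDiffOn_id.congr fun x hx => hρ' x (le_of_lt hx))
  have hG0 : ∀ x, G x ≠ 0 := by
    intro x hx
    have := hGd x
    simp [hx] at this
  refine no_contDiff_retraction (r := fun x => ((ρ' + 1) * ‖G x‖⁻¹) • G x) (R := ρ' + 1)
    ?_ (by linarith) (fun x hx => ?_) fun x => ?_
  · exact (contDiff_const.mul ((hGs.norm ℝ hG0).inv fun x => norm_ne_zero_iff.2 (hG0 x))).smul hGs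
  · have : G x = x := by
      rw [hGeq (show ρ' + 1 ≤ ‖x‖ from hx.ge), hρ' x (by linarith)]
    simp only [this, hx]
    rw [mul_inv_cancel₀ (by linarith), one_smul]
  · rw [norm_smul, norm_mul, norm_inv, norm_norm, mul_assoc,
      inv_mul_cancel₀ (norm_ne_zero_iff.2 (hG0 x)), mul_one, Real.norm_of_nonneg (by linarith)]

open intervalIntegral

/-- One step of a truncated gradient descent. -/
noncomputable def descentStep {V : Type*} [AddCommGroup V] [Module ℝ V]
    (Φ : V → ℝ) (g : V → V) (L β : ℝ) (x : V) : V :=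
  x - ((2 * L)⁻¹ * max 0 (min 1 (4 * Φ x / β - 1))) • g x

section descent
variable {V : Type*} [NormedAddCommGroup V] [InnerProductSpace ℝ V]
  {Φ : V → ℝ} {g : V → V} {L β : ℝ}

theorem continuous_descentStep (hΦ : Continuous Φ) (hg : Continuous g) :
    Continuous (descentStep Φ g L β) := by
  unfold descentStep
  fun_prop

theorem descentStep_eq_self (hβ : 0 < β) {x : V} (hx : Φ x ≤ 0) : descentStep Φ g L β x = x := by
  have : 4 * Φ x / β ≤ 0 := div_nonpos_of_nonpos_of_nonneg (by linarith) hβ.le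
  rw [descentStep, max_eq_left ((min_le_right _ _).trans (by linarith))]
  simp

theorem descentStep_le (hL : 0 < L)
    (hdesc : ∀ x w, Φ (x + w) ≤ Φ x + inner ℝ (g x) w + L * ‖w‖ ^ 2) (x : V) :
    Φ (descentStep Φ g L β x) ≤
      Φ x - (4 * L)⁻¹ * max 0 (min 1 (4 * Φ x / β - 1)) * ‖g x‖ ^ 2 := by
  set χ := max 0 (min 1 (4 * Φ x / β - 1)) with hχ
  have h0 : 0 ≤ χ := le_max_left _ _
  have h1 : χ ≤ 1 := max_le zero_le_one (min_le_left _ _)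
  have h := hdesc x (-(((2 * L)⁻¹ * χ) • g x))
  rw [← sub_eq_add_neg, inner_neg_right, inner_smul_right, real_inner_self_eq_norm_sq, norm_neg,
    norm_smul, mul_pow, Real.norm_eq_abs, sq_abs] at h
  refine h.trans ?_
  have h2 : L * (((2 * L)⁻¹ * χ) ^ 2 * ‖g x‖ ^ 2) = (4 * L)⁻¹ * χ ^ 2 * ‖g x‖ ^ 2 := by
    field_simp; ring
  have h3 : (2 * L)⁻¹ * χ * ‖g x‖ ^ 2 = 2 * ((4 * L)⁻¹ * χ * ‖g x‖ ^ 2) := by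
    field_simp; ring
  have h4 : (4 * L)⁻¹ * χ ^ 2 * ‖g x‖ ^ 2 ≤ (4 * L)⁻¹ * χ * ‖g x‖ ^ 2 := by
    have : χ ^ 2 ≤ χ := by nlinarith
    gcongr
  rw [h2]
  linarith

theorem descentStep_iterate_le (hL : 0 < L) (hβ : 0 < β)
    (hdesc : ∀ x w, Φ (x + w) ≤ Φ x + inner ℝ (g x) w + L * ‖w‖ ^ 2)
    {δ : ℝ} (hδ : 0 < δ) (hgδ : ∀ x, β / 2 ≤ Φ x → δ ≤ ‖g x‖) (x : V) (k : ℕ) :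
    Φ ((descentStep Φ g L β)^[k] x) ≤ max (β / 2) (Φ x - k * ((4 * L)⁻¹ * δ ^ 2)) := by
  induction k with
  | zero => simp
  | succ k ih =>
    rw [Function.iterate_succ_apply']
    set y := (descentStep Φ g L β)^[k] x
    have h := descentStep_le (β := β) hL hdesc y
    rcases le_total (β / 2) (Φ y) with hy | hy
    · have hχ : max 0 (min 1 (4 * Φ y / β - 1)) = 1 := by
        have : (2 : ℝ) ≤ 4 * Φ y / β := by rw [le_div_iff₀ hβ]; linarith
        rw [min_eq_left (by linarith), max_eq_right zero_le_one]
      rw [hχ, mul_one] at h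
      have h1 : (4 * L)⁻¹ * δ ^ 2 ≤ (4 * L)⁻¹ * ‖g y‖ ^ 2 := by
        have := hgδ y hy
        gcongr
      rcases le_max_iff.1 ih with h2 | h2
      · refine le_max_of_le_left ?_
        have : 0 ≤ (4 * L)⁻¹ * δ ^ 2 := by positivity
        linarith
      · refine le_max_of_le_right ?_
        push_cast
        linarith
    · refine le_max_of_le_left (h.trans ?_)
      have : 0 ≤ (4 * L)⁻¹ * max 0 (min 1 (4 * Φ y / β - 1)) * ‖g y‖ ^ 2 := by positivity
      linarith

/-- A linking theorem: a function which is nonpositive on the boundary of a half space of the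
range of `P` enlarged by the direction `e`, and at least `β` on a sphere of the kernel of `P`,
has a critical point at level at least `β / 2`. -/
theorem exists_critical_point_of_linking [FiniteDimensional ℝ V]
    (hΦ : Continuous Φ) (hg : Continuous g) (hL : 0 < L)
    (hdesc : ∀ x w, Φ (x + w) ≤ Φ x + inner ℝ (g x) w + L * ‖w‖ ^ 2)
    {P : V →L[ℝ] V} (hP : ∀ x, P (P x) = P x) {e : V} (hPe : P e = 0) (he : ‖e‖ = 1)
    (h0 : ∀ y, P y = y → Φ y ≤ 0) {ρ : ℝ}
    (hρ : ∀ y (s : ℝ), P y = y → 0 ≤ s → ρ ≤ max ‖y‖ s → Φ (y + s • e) ≤ 0)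
    {α : ℝ} (hα : 0 < α) (hβ : 0 < β) (hΓ : ∀ x, P x = 0 → ‖x‖ = α → β ≤ Φ x)
    {B : ℝ} (hB : ∀ x, B ≤ ‖x‖ → 1 ≤ ‖g x‖) : ∃ x, g x = 0 ∧ β / 2 ≤ Φ x := by
  by_contra! hcrit
  obtain ⟨δ, hδ, hgδ⟩ : ∃ δ > 0, ∀ x, β / 2 ≤ Φ x → δ ≤ ‖g x‖ := by
    have hK : IsCompact (closedBall (0 : V) B ∩ {x | β / 2 ≤ Φ x}) :=
      (isCompact_closedBall _ _).inter_right (isClosed_le continuous_const hΦ)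
    obtain ⟨δ, hδ, hδK⟩ := hK.exists_forall_le' hg.norm.continuousOn (a := 0)
      (fun x hx => norm_pos_iff.2 fun h => (hcrit x h).not_ge hx.2)
    refine ⟨min δ 1, by positivity, fun x hx => ?_⟩
    rcases le_total B ‖x‖ with h | h
    · exact (min_le_right _ _).trans (hB x h)
    · exact (min_le_left _ _).trans (hδK x ⟨by simpa using h, hx⟩)
  let K : Submodule ℝ V := LinearMap.eqLocus (P : V →ₗ[ℝ] V) LinearMap.id
  have hK : ∀ y : K, P y = y := fun y => y.2
  obtain ⟨M, hM⟩ : ∃ M, ∀ p : K × ℝ, Φ (p.1 + max p.2 0 • e) ≤ M := by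
    have hc : Continuous fun p : K × ℝ => Φ (p.1 + max p.2 0 • e) := by fun_prop
    obtain ⟨M, hM⟩ := ((isCompact_closedBall (0 : K × ℝ) ρ).image hc).bddAbove
    refine ⟨max M 0, fun p => ?_⟩
    rcases le_total ‖p‖ ρ with h | h
    · exact le_max_of_le_left (hM ⟨p, by simpa using h, rfl⟩)
    · refine le_max_of_le_right ?_
      rcases le_total p.2 0 with h2 | h2
      · rw [max_eq_right h2, zero_smul, add_zero]
        exact h0 _ (hK _)
      · rw [max_eq_left h2]
        refine hρ _ _ (hK _) h2 ?_
        rwa [Prod.norm_def, Real.norm_of_nonneg h2] at h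
  obtain ⟨k, hk⟩ := exists_nat_gt (M / ((4 * L)⁻¹ * δ ^ 2))
  rw [div_lt_iff₀ (by positivity)] at hk
  set h := (descentStep Φ g L β)^[k]
  have hcont : Continuous h := (continuous_descentStep hΦ hg).iterate k
  have hfix : ∀ x, Φ x ≤ 0 → h x = x := fun x hx =>
    Function.iterate_fixed (descentStep_eq_self hβ hx) k
  let G : K × ℝ → K × ℝ := fun p =>
    (⟨P (h (p.1 + max p.2 0 • e)), hP _⟩,
      ‖h (p.1 + max p.2 0 • e) - P (h (p.1 + max p.2 0 • e))‖ - max (-p.2) 0)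
  have hG : Continuous G := by
    refine Continuous.prodMk (Continuous.subtype_mk (by fun_prop) _) (by fun_prop)
  have hGneg : ∀ p : K × ℝ, p.2 ≤ 0 → G p = p := by
    intro p hp
    have h1 : h (p.1 + max p.2 0 • e) = p.1 := by
      rw [max_eq_right hp, zero_smul, add_zero]
      exact hfix _ (h0 _ (hK _))
    refine Prod.ext (Subtype.ext ?_) ?_
    · simp only [G, h1, hK]
    · simp only [G, h1, hK, sub_self, norm_zero, zero_sub]
      rw [max_eq_left (by linarith), neg_neg]
  have hGid : ∀ p, ρ ≤ ‖p‖ → G p = p := by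
    intro p hp
    rcases le_total p.2 0 with h2 | h2
    · exact hGneg p h2
    · rw [Prod.norm_def, Real.norm_of_nonneg h2] at hp
      have h1 : h (p.1 + max p.2 0 • e) = p.1 + p.2 • e := by
        rw [max_eq_left h2]
        exact hfix _ (hρ _ _ (hK _) h2 hp)
      have h3 : P (p.1 + p.2 • e) = p.1 := by
        rw [map_add, map_smul, hPe, smul_zero, add_zero, hK]
      refine Prod.ext (Subtype.ext ?_) ?_
      · simp only [G, h1, h3]
      · simp only [G, h1, h3, add_sub_cancel_left]
        rw [norm_smul, he, mul_one, Real.norm_of_nonneg h2, max_eq_right (by linarith), sub_zero]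
  obtain ⟨p, hp⟩ := surjective_of_eq_id_outside_ball hG hGid (0, α)
  have hp2 : 0 < p.2 := by
    by_contra! hle
    rw [hGneg p hle] at hp
    rw [hp] at hle
    exact hα.not_ge hle
  have hp1 : P (h (p.1 + max p.2 0 • e)) = 0 := congrArg (fun q => (q.1 : V)) hp
  have hp3 : ‖h (p.1 + max p.2 0 • e)‖ = α := by
    have : ‖h (p.1 + max p.2 0 • e) - P (h (p.1 + max p.2 0 • e))‖ - max (-p.2) 0 = α :=
      congrArg Prod.snd hp
    rwa [hp1, sub_zero, max_eq_right (show -p.2 ≤ 0 by linarith), sub_zero] at this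
  have hlow := hΓ _ hp1 hp3
  have hup := descentStep_iterate_le hL hβ hdesc hδ hgδ (p.1 + max p.2 0 • e) k
  have : max (β / 2) (Φ (p.1 + max p.2 0 • e) - k * ((4 * L)⁻¹ * δ ^ 2)) < β :=
    max_lt (by linarith) (by linarith [hM p])
  exact (hlow.trans hup).not_gt this

end descent

/-- An orthogonal complex structure on a real inner product space. -/
structure IsOrthogonalComplexStructure {E : Type*} [NormedAddCommGroup E] [InnerProductSpace ℝ E]
    (J : E →L[ℝ] E) : Prop where
  sq : ∀ x, J (J x) = -x
  inner_map : ∀ x y, inner ℝ (J x) (J y) = inner ℝ x y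

/-- The rotation `cos θ + J sin θ` generated by `J`. -/
noncomputable def rot {E : Type*} [NormedAddCommGroup E] [InnerProductSpace ℝ E]
    (J : E →L[ℝ] E) (θ : ℝ) (x : E) : E :=
  Real.cos θ • x + Real.sin θ • J x

section rotation
variable {E : Type*} [NormedAddCommGroup E] [InnerProductSpace ℝ E] {J : E →L[ℝ] E}

@[fun_prop]
theorem continuous_rot {X : Type*} [TopologicalSpace X] {θ : X → ℝ} {u : X → E}
    (hθ : Continuous θ) (hu : Continuous u) : Continuous fun x => rot J (θ x) (u x) := by
  unfold rot
  fun_prop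

theorem rot_add (θ : ℝ) (x y : E) : rot J θ (x + y) = rot J θ x + rot J θ y := by
  simp only [rot, map_add]; module

theorem rot_smul (θ r : ℝ) (x : E) : rot J θ (r • x) = r • rot J θ x := by
  simp only [rot, map_smul]; module

theorem rot_zero (x : E) : rot J 0 x = x := by simp [rot]

theorem hasDerivAt_rot (a t : ℝ) (x : E) :
    HasDerivAt (fun t => rot J (a * t) x) (J (rot J (a * t) (a • x)) +
      (Real.sin (a * t) * a) • (-x - J (J x))) t := by
  have h := (hasDerivAt_id t).const_mul a
  have h1 := ((h.cos.smul_const x).add (h.sin.smul_const (J x)))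
  refine h1.congr_deriv ?_
  simp only [rot, map_add, map_smul, id, mul_one]
  module

namespace IsOrthogonalComplexStructure
theorem inner_left (hJ : IsOrthogonalComplexStructure J) (x y : E) :
    inner ℝ (J x) y = -inner ℝ x (J y) := by
  rw [← hJ.inner_map x (J y), hJ.sq, inner_neg_right, neg_neg]

theorem inner_self (hJ : IsOrthogonalComplexStructure J) (x : E) : inner ℝ x (J x) = 0 := by
  have := hJ.inner_left x x
  rw [real_inner_comm] at this
  linarith

theorem norm_map (hJ : IsOrthogonalComplexStructure J) (x : E) : ‖J x‖ = ‖x‖ := by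
  have := hJ.inner_map x x
  rw [real_inner_self_eq_norm_sq, real_inner_self_eq_norm_sq] at this
  exact (sq_eq_sq₀ (norm_nonneg _) (norm_nonneg _)).1 this

theorem inner_rot_rot (hJ : IsOrthogonalComplexStructure J) (a b : ℝ) (x y : E) :
    inner ℝ (rot J a x) (rot J b y) =
    Real.cos (b - a) * inner ℝ x y + Real.sin (b - a) * inner ℝ x (J y) := by
  simp only [rot, inner_add_left, inner_add_right, inner_smul_left, inner_smul_right,
    hJ.inner_map, hJ.inner_left x y, Real.cos_sub, Real.sin_sub]
  simp only [conj_trivial]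
  ring

theorem norm_rot (hJ : IsOrthogonalComplexStructure J) (a : ℝ) (x : E) : ‖rot J a x‖ = ‖x‖ := by
  have := hJ.inner_rot_rot a a x x
  rw [real_inner_self_eq_norm_sq, sub_self, Real.cos_zero, Real.sin_zero, one_mul, zero_mul,
    add_zero, real_inner_self_eq_norm_sq] at this
  exact (sq_eq_sq₀ (norm_nonneg _) (norm_nonneg _)).1 this

theorem inner_rot_right (hJ : IsOrthogonalComplexStructure J) (a : ℝ) (x y : E) :
    inner ℝ x (rot J a y) = inner ℝ (rot J (-a) x) y := by
  have h1 := hJ.inner_rot_rot 0 a x y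
  have h2 := hJ.inner_rot_rot (-a) 0 x y
  rw [rot_zero] at h1 h2
  rw [h1, h2]
  simp

theorem hasDerivAt_rot (hJ : IsOrthogonalComplexStructure J) (a t : ℝ) (x : E) :
    HasDerivAt (fun t => rot J (a * t) x) (J (rot J (a * t) (a • x))) t := by
  have := _root_.hasDerivAt_rot (J := J) a t x
  rwa [hJ.sq, sub_neg_eq_add, neg_add_cancel, smul_zero, add_zero] at this

end IsOrthogonalComplexStructure

end rotation

theorem integral_cos_two_pi_int (m : ℤ) :
    ∫ t in (0 : ℝ)..1, Real.cos (2 * Real.pi * m * t) = if m = 0 then 1 else 0 := by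
  split_ifs with h
  · simp [h]
  · have : (2 * Real.pi * m : ℝ) ≠ 0 := by
      have : (m : ℝ) ≠ 0 := by exact_mod_cast h
      positivity
    rw [integral_comp_mul_left _ this, integral_cos]
    have h2 : Real.sin (2 * Real.pi * m) = 0 := by
      have := Real.sin_int_mul_pi (2 * m)
      rw [← this]; push_cast; ring_nf
    simp [h2]

theorem integral_sin_two_pi_int (m : ℤ) :
    ∫ t in (0 : ℝ)..1, Real.sin (2 * Real.pi * m * t) = 0 := by
  by_cases h : m = 0
  · simp [h]
  · have : (2 * Real.pi * m : ℝ) ≠ 0 := by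
      have : (m : ℝ) ≠ 0 := by exact_mod_cast h
      positivity
    rw [integral_comp_mul_left _ this, integral_sin]
    have h2 : Real.cos (2 * Real.pi * m) = 1 := by
      convert Real.cos_int_mul_two_pi m using 2
      ring
    simp [h2]

/-- Coefficients of `E`-valued trigonometric polynomials with frequencies in `s`. -/
abbrev TrigCoeff (E : Type*) (s : Finset ℤ) := PiLp 2 (fun _ : s => E)

section trig
variable {E : Type*} [NormedAddCommGroup E] [InnerProductSpace ℝ E] {J : E →L[ℝ] E}
  {s : Finset ℤ}

/-- The trigonometric polynomial with coefficients `c`. -/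
noncomputable def trig (J : E →L[ℝ] E) (c : TrigCoeff E s) (t : ℝ) : E :=
  ∑ k : s, rot J (2 * Real.pi * (k : ℤ) * t) (c k)

/-- The `k`-th Fourier coefficient of `w`. -/
noncomputable def trigCoeff (J : E →L[ℝ] E) (w : ℝ → E) (k : ℤ) : E :=
  ∫ t in (0 : ℝ)..1, rot J (-(2 * Real.pi * k * t)) (w t)

/-- The Fourier multiplier with symbol `m`. -/
noncomputable def trigMul (m : ℤ → ℝ) : TrigCoeff E s →ₗ[ℝ] TrigCoeff E s where
  toFun c := WithLp.toLp 2 fun k => m k • c k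
  map_add' c d := by ext k; simp
  map_smul' r c := by ext k; exact smul_comm _ _ _

@[simp]
theorem trigMul_apply (m : ℤ → ℝ) (c : TrigCoeff E s) (k : s) : trigMul m c k = m k • c k := rfl

theorem TrigCoeff.norm_sq {E : Type*} [NormedAddCommGroup E] {s : Finset ℤ}
    (c : TrigCoeff E s) : ‖c‖ ^ 2 = ∑ k : s, ‖c k‖ ^ 2 :=
  PiLp.norm_sq_eq_of_L2 _ c

theorem trig_add (c d : TrigCoeff E s) (t : ℝ) : trig J (c + d) t = trig J c t + trig J d t := by
  simp [trig, rot_add, Finset.sum_add_distrib]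

@[fun_prop]
theorem continuous_trig {X : Type*} [TopologicalSpace X] {c : X → TrigCoeff E s} {θ : X → ℝ}
    (hc : Continuous c) (hθ : Continuous θ) : Continuous fun x => trig J (c x) (θ x) := by
  unfold trig
  fun_prop

theorem trig_periodic (c : TrigCoeff E s) (t : ℝ) : trig J c (t + 1) = trig J c t := by
  refine Finset.sum_congr rfl fun k _ => ?_
  have h : 2 * Real.pi * ((k : ℤ) : ℝ) * (t + 1) =
    2 * Real.pi * ((k : ℤ) : ℝ) * t + (k : ℤ) * (2 * Real.pi) := by ring
  simp only [rot, h, Real.cos_add_int_mul_two_pi, Real.sin_add_int_mul_two_pi]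

theorem norm_trig_le (hJ : IsOrthogonalComplexStructure J) (c : TrigCoeff E s) (t : ℝ) :
    ‖trig J c t‖ ≤ ∑ k : s, ‖c k‖ :=
  (norm_sum_le _ _).trans_eq (Finset.sum_congr rfl fun _ _ => hJ.norm_rot _ _)

theorem hasDerivAt_trig (hJ : IsOrthogonalComplexStructure J) (c : TrigCoeff E s) (t : ℝ) :
    HasDerivAt (trig J c) (J (trig J (trigMul (fun k => 2 * Real.pi * k) c) t)) t := by
  have := HasDerivAt.fun_sum (u := (Finset.univ : Finset s)) fun k _ =>
    hJ.hasDerivAt_rot (2 * Real.pi * (k : ℤ)) t (c k)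
  simpa [trig, map_sum] using! this

variable [CompleteSpace E]

theorem integral_inner_trig (hJ : IsOrthogonalComplexStructure J) {w : ℝ → E}
    (hw : Continuous w) (d : TrigCoeff E s) :
    ∫ t in (0 : ℝ)..1, inner ℝ (w t) (trig J d t) = ∑ k : s, inner ℝ (trigCoeff J w k) (d k) := by
  have h : ∀ t, inner ℝ (w t) (trig J d t) =
      ∑ k : s, inner ℝ (d k) (rot J (-(2 * Real.pi * (k : ℤ) * t)) (w t)) := by
    intro t
    rw [trig, inner_sum]
    refine Finset.sum_congr rfl fun k _ => ?_
    rw [hJ.inner_rot_right, real_inner_comm]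
  simp_rw [h]
  rw [integral_finsetSum fun k _ => (by fun_prop : Continuous _).intervalIntegrable _ _]
  refine Finset.sum_congr rfl fun k _ => ?_
  rw [real_inner_comm, trigCoeff]
  exact (innerSL ℝ (d k)).intervalIntegral_comp_comm
    ((by fun_prop : Continuous _).intervalIntegrable _ _)

theorem trigCoeff_trig (hJ : IsOrthogonalComplexStructure J) (c : TrigCoeff E s) (k : s) :
    trigCoeff J (trig J c) k = c k := by
  have h : ∀ t, rot J (-(2 * Real.pi * (k : ℤ) * t)) (trig J c t) =
      ∑ j : s, (Real.cos (2 * Real.pi * (j - k : ℤ) * t) • c j +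
        Real.sin (2 * Real.pi * (j - k : ℤ) * t) • J (c j)) := by
    intro t
    simp only [trig, rot, map_sum, map_add, map_smul, hJ.sq, Finset.smul_sum,
      ← Finset.sum_add_distrib, Real.cos_neg, Real.sin_neg]
    refine Finset.sum_congr rfl fun j _ => ?_
    have : 2 * Real.pi * ((j - k : ℤ) : ℝ) * t = 2 * Real.pi * (j : ℤ) * t -
      2 * Real.pi * (k : ℤ) * t := by push_cast; ring
    rw [this, Real.cos_sub, Real.sin_sub]
    module
  simp_rw [trigCoeff, h]
  rw [integral_finsetSum fun k _ => (by fun_prop : Continuous _).intervalIntegrable _ _]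
  rw [Finset.sum_eq_single k]
  · simp
  · intro j _ hjk
    rw [integral_add ((by fun_prop : Continuous _).intervalIntegrable _ _)
      ((by fun_prop : Continuous _).intervalIntegrable _ _), intervalIntegral.integral_smul_const,
      intervalIntegral.integral_smul_const, integral_cos_two_pi_int, integral_sin_two_pi_int,
      if_neg (sub_ne_zero.2 fun h => hjk (Subtype.ext h))]
    simp
  · simp

theorem integral_inner_trig_trig (hJ : IsOrthogonalComplexStructure J) (c d : TrigCoeff E s) :
    ∫ t in (0 : ℝ)..1, inner ℝ (trig J c t) (trig J d t) = inner ℝ c d := by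
  rw [integral_inner_trig hJ (by fun_prop), PiLp.inner_apply]
  exact Finset.sum_congr rfl fun k _ => by rw [trigCoeff_trig hJ]

theorem integral_norm_trig_sq (hJ : IsOrthogonalComplexStructure J) (c : TrigCoeff E s) :
    ∫ t in (0 : ℝ)..1, ‖trig J c t‖ ^ 2 = ‖c‖ ^ 2 := by
  simp_rw [← real_inner_self_eq_norm_sq]
  exact integral_inner_trig_trig hJ c c

end trig

/-- A nonnegative Hamiltonian `H` with gradient `h` that vanishes near the origin and is
asymptotic to `(3π/2)‖z‖²` at infinity. -/
structure IsAsymptoticallyQuadratic {E : Type*} [NormedAddCommGroup E] [InnerProductSpace ℝ E]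
    (H : E → ℝ) (h : E → E) (K r C b B : ℝ) : Prop where
  continuous_fun : Continuous H
  continuous_grad : Continuous h
  nonneg_K : 0 ≤ K
  descent : ∀ z w, H z + inner ℝ (h z) w - K * ‖w‖ ^ 2 ≤ H (z + w)
  nonneg : ∀ z, 0 ≤ H z
  pos_r : 0 < r
  eq_zero : ∀ z, ‖z‖ ≤ r → H z = 0
  nonneg_C : 0 ≤ C
  le_sq : ∀ z, H z ≤ C * ‖z‖ ^ 2
  nonneg_b : 0 ≤ b
  sq_le : ∀ z, 3 * Real.pi / 2 * ‖z‖ ^ 2 - b ≤ H z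
  norm_grad_sub_le : ∀ z, ‖h z - (3 * Real.pi) • z‖ ≤ B

section galerkin
variable {E : Type*} [NormedAddCommGroup E] [InnerProductSpace ℝ E] {J : E →L[ℝ] E}
  {s : Finset ℤ} {H : E → ℝ} {h : E → E} {K r C b B : ℝ}

/-- The symplectic action functional on trigonometric polynomials. -/
noncomputable def trigAction (J : E →L[ℝ] E) (H : E → ℝ) (c : TrigCoeff E s) : ℝ :=
  (∑ k : s, Real.pi * (k : ℤ) * ‖c k‖ ^ 2) - ∫ t in (0 : ℝ)..1, H (trig J c t)

/-- The gradient of `trigAction`. -/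
noncomputable def trigActionGrad (J : E →L[ℝ] E) (h : E → E) (c : TrigCoeff E s) :
    TrigCoeff E s :=
  WithLp.toLp 2 fun k => (2 * Real.pi * (k : ℤ)) • c k - trigCoeff J (fun t => h (trig J c t)) k

theorem continuous_trigAction (hH : Continuous H) :
    Continuous (trigAction J H : TrigCoeff E s → ℝ) := by
  refine Continuous.sub (by fun_prop) ?_
  exact continuous_parametric_intervalIntegral_of_continuous' (by fun_prop) _ _

theorem continuous_trigActionGrad (hh : Continuous h) :
    Continuous (trigActionGrad J h : TrigCoeff E s → TrigCoeff E s) := by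
  refine (PiLp.continuous_toLp 2 _).comp (continuous_pi fun k => Continuous.sub (by fun_prop) ?_)
  exact continuous_parametric_intervalIntegral_of_continuous' (by fun_prop) _ _

theorem integral_le_integral_of_continuous {u v : ℝ → ℝ} (hu : Continuous u) (hv : Continuous v)
    (huv : ∀ t, u t ≤ v t) : ∫ t in (0 : ℝ)..1, u t ≤ ∫ t in (0 : ℝ)..1, v t :=
  integral_mono zero_le_one (hu.intervalIntegrable _ _) (hv.intervalIntegrable _ _) huv

theorem inner_trigActionGrad [CompleteSpace E] (hJ : IsOrthogonalComplexStructure J)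
    (hh : Continuous h) (c w : TrigCoeff E s) :
    inner ℝ (trigActionGrad J h c) w = (∑ k : s, 2 * Real.pi * (k : ℤ) * inner ℝ (c k) (w k)) -
      ∫ t in (0 : ℝ)..1, inner ℝ (h (trig J c t)) (trig J w t) := by
  rw [integral_inner_trig hJ (by fun_prop), PiLp.inner_apply, ← Finset.sum_sub_distrib]
  simp [trigActionGrad, inner_sub_left, inner_smul_left]

theorem trigAction_add_le [CompleteSpace E] (hJ : IsOrthogonalComplexStructure J)
    (hH : IsAsymptoticallyQuadratic H h K r C b B) (c w : TrigCoeff E s) :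
    trigAction J H (c + w) ≤ trigAction J H c + inner ℝ (trigActionGrad J h c) w +
      (∑ k : s, Real.pi * |((k : ℤ) : ℝ)| + K + 1) * ‖w‖ ^ 2 := by
  have hc := hH.continuous_fun
  have hh := hH.continuous_grad
  have h1 : (∫ t in (0 : ℝ)..1, H (trig J c t)) +
      (∫ t in (0 : ℝ)..1, inner ℝ (h (trig J c t)) (trig J w t)) - K * ‖w‖ ^ 2 ≤
      ∫ t in (0 : ℝ)..1, H (trig J (c + w) t) := by
    rw [← integral_norm_trig_sq hJ, ← intervalIntegral.integral_const_mul,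
      ← integral_add ((by fun_prop : Continuous _).intervalIntegrable _ _)
        ((by fun_prop : Continuous _).intervalIntegrable _ _),
      ← integral_sub ((by fun_prop : Continuous _).intervalIntegrable _ _)
        ((by fun_prop : Continuous _).intervalIntegrable _ _)]
    refine integral_le_integral_of_continuous (by fun_prop) (by fun_prop) fun t => ?_
    rw [trig_add]
    exact hH.descent _ _
  have h2 : ∑ k : s, Real.pi * (k : ℤ) * ‖(c + w) k‖ ^ 2 ≤
      (∑ k : s, Real.pi * (k : ℤ) * ‖c k‖ ^ 2) +
      (∑ k : s, 2 * Real.pi * (k : ℤ) * inner ℝ (c k) (w k)) +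
      (∑ k : s, Real.pi * |((k : ℤ) : ℝ)|) * ‖w‖ ^ 2 := by
    rw [Finset.sum_mul, ← Finset.sum_add_distrib, ← Finset.sum_add_distrib]
    refine Finset.sum_le_sum fun k _ => ?_
    rw [PiLp.add_apply, norm_add_sq_real]
    have h3 : Real.pi * (k : ℤ) * ‖w k‖ ^ 2 ≤ Real.pi * |((k : ℤ) : ℝ)| * ‖w‖ ^ 2 := by
      have : ‖w k‖ ≤ ‖w‖ := PiLp.norm_apply_le w k
      gcongr
      exact le_abs_self _
    linarith
  rw [inner_trigActionGrad hJ hh, trigAction, trigAction]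
  nlinarith [sq_nonneg ‖w‖]

theorem trigAction_le_of_high_eq_zero [CompleteSpace E] (hJ : IsOrthogonalComplexStructure J)
    (hH : IsAsymptoticallyQuadratic H h K r C b B) {c : TrigCoeff E s}
    (hc : ∀ k : s, 1 < (k : ℤ) → c k = 0) :
    trigAction J H c ≤ b - Real.pi / 2 * ‖c‖ ^ 2 := by
  have hHc := hH.continuous_fun
  have h1 : 3 * Real.pi / 2 * ‖c‖ ^ 2 - b ≤ ∫ t in (0 : ℝ)..1, H (trig J c t) := by
    have : 3 * Real.pi / 2 * ‖c‖ ^ 2 - b =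
        ∫ t in (0 : ℝ)..1, (3 * Real.pi / 2 * ‖trig J c t‖ ^ 2 - b) := by
      rw [integral_sub ((by fun_prop : Continuous _).intervalIntegrable _ _)
        ((by fun_prop : Continuous _).intervalIntegrable _ _),
        intervalIntegral.integral_const_mul, integral_norm_trig_sq hJ]
      simp
    rw [this]
    exact integral_le_integral_of_continuous (by fun_prop) (by fun_prop) fun t => hH.sq_le _
  have h2 : ∑ k : s, Real.pi * (k : ℤ) * ‖c k‖ ^ 2 ≤ Real.pi * ‖c‖ ^ 2 := by
    rw [TrigCoeff.norm_sq, Finset.mul_sum]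
    refine Finset.sum_le_sum fun k _ => ?_
    by_cases hk : 1 < (k : ℤ)
    · simp [hc k hk]
    · have : ((k : ℤ) : ℝ) ≤ 1 := by exact_mod_cast not_lt.1 hk
      have := Real.pi_pos
      gcongr
      nlinarith
  rw [trigAction]
  linarith

theorem trigAction_nonpos (hH : IsAsymptoticallyQuadratic H h K r C b B) {c : TrigCoeff E s}
    (hc : ∀ k : s, 0 < (k : ℤ) → c k = 0) : trigAction J H c ≤ 0 := by
  have h1 : 0 ≤ ∫ t in (0 : ℝ)..1, H (trig J c t) :=
    integral_nonneg zero_le_one fun t _ => hH.nonneg _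
  have h2 : ∑ k : s, Real.pi * (k : ℤ) * ‖c k‖ ^ 2 ≤ 0 := by
    refine Finset.sum_nonpos fun k _ => ?_
    by_cases hk : 0 < (k : ℤ)
    · simp [hc k hk]
    · have : ((k : ℤ) : ℝ) ≤ 0 := by exact_mod_cast not_lt.1 hk
      have := Real.pi_pos
      exact mul_nonpos_of_nonpos_of_nonneg (by nlinarith) (sq_nonneg _)
  rw [trigAction]
  linarith

theorem IsAsymptoticallyQuadratic.apply_add_le (hH : IsAsymptoticallyQuadratic H h K r C b B)
    {p : E} (hp : ‖p‖ ≤ r / 2) (q : E) : H (p + q) ≤ 4 * C * ‖q‖ ^ 2 := by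
  have hC := hH.nonneg_C
  rcases le_or_gt ‖p + q‖ r with hr | hr
  · rw [hH.eq_zero _ hr]; positivity
  · have h1 := norm_add_le p q
    have h2 : ‖p + q‖ ≤ 2 * ‖q‖ := by linarith
    calc H (p + q) ≤ C * ‖p + q‖ ^ 2 := hH.le_sq _
      _ ≤ C * (2 * ‖q‖) ^ 2 := by gcongr
      _ = _ := by ring

theorem le_trigAction_of_low_eq_zero [CompleteSpace E] (hJ : IsOrthogonalComplexStructure J)
    (hH : IsAsymptoticallyQuadratic H h K r C b B) {K₀ : ℕ} (hK₀ : 8 * C / Real.pi ≤ K₀)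
    (hK1 : 1 ≤ K₀) {c : TrigCoeff E s}
    (hc : ∀ k : s, (k : ℤ) ≤ 0 → c k = 0) (hr : ‖c‖ ≤ r / (2 * K₀)) :
    Real.pi / 2 * ‖c‖ ^ 2 ≤ trigAction J H c := by
  have hHc := hH.continuous_fun
  have hpi := Real.pi_pos
  have hC := hH.nonneg_C
  have hK : (0 : ℝ) < K₀ := by exact_mod_cast hK1
  rw [div_le_iff₀ hpi] at hK₀
  set u : TrigCoeff E s := trigMul (fun k => if k ≤ K₀ then 1 else 0) c with hu
  set w : TrigCoeff E s := trigMul (fun k => if k ≤ K₀ then 0 else 1) c with hw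
  have huw : c = u + w := by
    ext k
    simp only [hu, hw, PiLp.add_apply, trigMul_apply]
    split_ifs <;> simp
  have hut : ∀ t, ‖trig J u t‖ ≤ r / 2 := by
    intro t
    have h1 : ∀ k : s, ‖u k‖ ≤ if (k : ℤ) ∈ Finset.Icc (1 : ℤ) K₀ then ‖c‖ else 0 := by
      intro k
      simp only [hu, trigMul_apply, Finset.mem_Icc]
      by_cases hk0 : (k : ℤ) ≤ 0
      · rw [hc k hk0]
        simp only [smul_zero, norm_zero]
        split_ifs <;> simp
      · by_cases hk1 : (k : ℤ) ≤ K₀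
        · rw [if_pos hk1, if_pos ⟨by lia, hk1⟩, one_smul]
          exact PiLp.norm_apply_le c k
        · simp [hk1]
    calc ‖trig J u t‖ ≤ ∑ k : s, ‖u k‖ := norm_trig_le hJ _ _
      _ ≤ ∑ k : s, if (k : ℤ) ∈ Finset.Icc (1 : ℤ) K₀ then ‖c‖ else 0 :=
        Finset.sum_le_sum fun k _ => h1 k
      _ = ∑ k ∈ s, if k ∈ Finset.Icc (1 : ℤ) K₀ then ‖c‖ else 0 :=
        Finset.sum_coe_sort s fun k => if k ∈ Finset.Icc (1 : ℤ) K₀ then ‖c‖ else 0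
      _ = (s.filter (· ∈ Finset.Icc (1 : ℤ) K₀)).card * ‖c‖ := by
        rw [← Finset.sum_filter, Finset.sum_const, nsmul_eq_mul]
      _ ≤ K₀ * ‖c‖ := by
        gcongr
        have : (s.filter (· ∈ Finset.Icc (1 : ℤ) K₀)) ⊆ Finset.Icc (1 : ℤ) K₀ :=
          fun k hk => (Finset.mem_filter.1 hk).2
        simpa using Finset.card_le_card this
      _ ≤ K₀ * (r / (2 * K₀)) := by gcongr
      _ = r / 2 := by field_simp
  have h1 : ∫ t in (0 : ℝ)..1, H (trig J c t) ≤ 4 * C * ‖w‖ ^ 2 := by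
    rw [← integral_norm_trig_sq hJ, ← intervalIntegral.integral_const_mul]
    refine integral_le_integral_of_continuous (by fun_prop) (by fun_prop) fun t => ?_
    conv_lhs => rw [huw, trig_add]
    exact hH.apply_add_le (hut t) _
  have h2 : Real.pi / 2 * ‖c‖ ^ 2 + 4 * C * ‖w‖ ^ 2 ≤
      ∑ k : s, Real.pi * (k : ℤ) * ‖c k‖ ^ 2 := by
    rw [TrigCoeff.norm_sq, TrigCoeff.norm_sq, Finset.mul_sum, Finset.mul_sum,
      ← Finset.sum_add_distrib]
    refine Finset.sum_le_sum fun k _ => ?_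
    simp only [hw, trigMul_apply]
    by_cases hk0 : (k : ℤ) ≤ 0
    · simp [hc k hk0]
    · have hk1 : (1 : ℝ) ≤ ((k : ℤ) : ℝ) := by exact_mod_cast (not_le.1 hk0)
      by_cases hk : (k : ℤ) ≤ K₀
      · simp only [hk, if_true, zero_smul, norm_zero]
        nlinarith [mul_le_mul_of_nonneg_right hk1 (mul_nonneg hpi.le (sq_nonneg ‖c k‖)),
          mul_nonneg hpi.le (sq_nonneg ‖c k‖)]
      · simp only [hk, if_false, one_smul]
        have hk2 : (K₀ : ℝ) ≤ ((k : ℤ) : ℝ) := by exact_mod_cast (not_le.1 hk).le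
        have : Real.pi / 2 + 4 * C ≤ Real.pi * (k : ℤ) := by nlinarith
        nlinarith [sq_nonneg ‖c k‖]
  rw [trigAction]
  linarith

theorem le_inner_trigActionGrad [CompleteSpace E] (hJ : IsOrthogonalComplexStructure J)
    (hH : IsAsymptoticallyQuadratic H h K r C b B) (c : TrigCoeff E s) :
    ∃ w : TrigCoeff E s, ‖w‖ = ‖c‖ ∧
      Real.pi / 2 * ‖c‖ ^ 2 - B ^ 2 / (2 * Real.pi) ≤ inner ℝ (trigActionGrad J h c) w := by
  have hh := hH.continuous_grad
  have hpi := Real.pi_pos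
  set m : ℤ → ℝ := fun k => if 2 ≤ k then 1 else -1 with hm
  set w : TrigCoeff E s := trigMul m c with hw
  have hm1 : ∀ k, |m k| = 1 := by intro k; simp only [hm]; split_ifs <;> simp
  have hwn : ‖w‖ ^ 2 = ‖c‖ ^ 2 := by
    rw [TrigCoeff.norm_sq, TrigCoeff.norm_sq]
    refine Finset.sum_congr rfl fun k _ => ?_
    rw [hw, trigMul_apply, norm_smul, Real.norm_eq_abs, hm1, one_mul]
  refine ⟨w, (sq_eq_sq₀ (norm_nonneg _) (norm_nonneg _)).1 hwn, ?_⟩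
  have h1 : ∫ t in (0 : ℝ)..1, inner ℝ (h (trig J c t)) (trig J w t) ≤
      3 * Real.pi * inner ℝ c w + (B ^ 2 / (2 * Real.pi) + Real.pi / 2 * ‖c‖ ^ 2) := by
    rw [← hwn, ← integral_inner_trig_trig hJ c w, ← integral_norm_trig_sq hJ]
    have : B ^ 2 / (2 * Real.pi) = ∫ t in (0 : ℝ)..1, B ^ 2 / (2 * Real.pi) := by simp
    rw [this, ← intervalIntegral.integral_const_mul, ← intervalIntegral.integral_const_mul,
      ← integral_add ((by fun_prop : Continuous _).intervalIntegrable _ _)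
        ((by fun_prop : Continuous _).intervalIntegrable _ _),
      ← integral_add ((by fun_prop : Continuous _).intervalIntegrable _ _)
        ((by fun_prop : Continuous _).intervalIntegrable _ _)]
    refine integral_le_integral_of_continuous (by fun_prop) (by fun_prop) fun t => ?_
    set x := trig J c t
    set y := trig J w t
    have e1 : inner ℝ (h x) y = 3 * Real.pi * inner ℝ x y + inner ℝ (h x - (3 * Real.pi) • x) y := by
      rw [inner_sub_left, inner_smul_left]; simp
    have e2 := real_inner_le_norm (h x - (3 * Real.pi) • x) y
    have e3 := hH.norm_grad_sub_le x
    have e4 : ‖h x - (3 * Real.pi) • x‖ * ‖y‖ ≤ B * ‖y‖ := by gcongr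
    have e5 : B * ‖y‖ ≤ B ^ 2 / (2 * Real.pi) + Real.pi / 2 * ‖y‖ ^ 2 := by
      rw [← sub_nonneg]
      have : B ^ 2 / (2 * Real.pi) + Real.pi / 2 * ‖y‖ ^ 2 - B * ‖y‖ =
        (B - Real.pi * ‖y‖) ^ 2 / (2 * Real.pi) := by field_simp; ring
      rw [this]; positivity
    linarith
  have h2 : Real.pi * ‖c‖ ^ 2 + 3 * Real.pi * inner ℝ c w ≤
      ∑ k : s, 2 * Real.pi * (k : ℤ) * inner ℝ (c k) (w k) := by
    rw [TrigCoeff.norm_sq, PiLp.inner_apply, Finset.mul_sum, Finset.mul_sum,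
      ← Finset.sum_add_distrib]
    refine Finset.sum_le_sum fun k _ => ?_
    simp only [hw, trigMul_apply, inner_smul_right, real_inner_self_eq_norm_sq]
    have hn := mul_nonneg hpi.le (sq_nonneg ‖c k‖)
    by_cases hk : 2 ≤ (k : ℤ)
    · have : (2 : ℝ) ≤ ((k : ℤ) : ℝ) := by exact_mod_cast hk
      simp only [hm, hk, if_true]
      nlinarith
    · have : ((k : ℤ) : ℝ) ≤ 1 := by exact_mod_cast (by lia : (k : ℤ) ≤ 1)
      simp only [hm, hk, if_false]
      nlinarith
  rw [inner_trigActionGrad hJ hh]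
  linarith

/-- Galerkin approximations of a periodic orbit. -/
theorem exists_trigActionGrad_eq_zero [FiniteDimensional ℝ E] [Nontrivial E]
    (hJ : IsOrthogonalComplexStructure J) {K₀ : ℕ} (hK₀ : 8 * C / Real.pi ≤ K₀) (hK1 : 1 ≤ K₀)
    (hH : IsAsymptoticallyQuadratic H h K r C b B) (hs : 1 ∈ s) :
    ∃ c : TrigCoeff E s, trigActionGrad J h c = 0 ∧
      Real.pi / 4 * (r / (2 * K₀)) ^ 2 ≤ trigAction J H c := by
  have : CompleteSpace E := FiniteDimensional.complete ℝ E
  have hpi := Real.pi_pos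
  have hpi3 := Real.pi_gt_three
  have hr := hH.pos_r
  have hK : (0 : ℝ) < K₀ := by exact_mod_cast hK1
  obtain ⟨v, hv⟩ := exists_norm_eq E zero_le_one
  set P : TrigCoeff E s →L[ℝ] TrigCoeff E s :=
    LinearMap.toContinuousLinearMap (trigMul fun k => if k ≤ 0 then 1 else 0) with hP
  have hPa : ∀ c k, P c k = (if (k : ℤ) ≤ 0 then (1 : ℝ) else 0) • c k := fun _ _ => rfl
  set e : TrigCoeff E s := WithLp.toLp 2 fun k => if (k : ℤ) = 1 then v else 0 with he
  have hea : ∀ k : s, e k = if (k : ℤ) = 1 then v else 0 := fun _ => rfl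
  have hfix : ∀ y : TrigCoeff E s, P y = y → ∀ k : s, 0 < (k : ℤ) → y k = 0 := by
    intro y hy k hk
    rw [← hy, hPa, if_neg (not_le.2 hk), zero_smul]
  have hker : ∀ y : TrigCoeff E s, P y = 0 → ∀ k : s, (k : ℤ) ≤ 0 → y k = 0 := by
    intro y hy k hk
    have : P y k = 0 := by rw [hy]; rfl
    rwa [hPa, if_pos hk, one_smul] at this
  have hen : ‖e‖ ^ 2 = 1 := by
    rw [TrigCoeff.norm_sq, Finset.sum_eq_single ⟨1, hs⟩]
    · simp [hea, hv]
    · intro k _ hk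
      rw [hea, if_neg fun h => hk (Subtype.ext h)]
      simp
    · simp
  have hen' : ‖e‖ = 1 := by nlinarith [norm_nonneg e]
  have hL : 0 < ∑ k : s, Real.pi * |((k : ℤ) : ℝ)| + K + 1 := by
    have := hH.nonneg_K
    positivity
  suffices hcrit : ∃ c : TrigCoeff E s, trigActionGrad J h c = 0 ∧
      Real.pi / 2 * (r / (2 * K₀)) ^ 2 / 2 ≤ trigAction J H c by
    obtain ⟨c, hc, hc2⟩ := hcrit
    exact ⟨c, hc, by linarith⟩
  refine exists_critical_point_of_linking (V := TrigCoeff E s)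
    (Φ := trigAction J H) (g := trigActionGrad J h) (P := P) (e := e) (ρ := 1 + b)
    (α := r / (2 * K₀)) (β := Real.pi / 2 * (r / (2 * K₀)) ^ 2) (B := 1 + B ^ 2)
    (continuous_trigAction hH.continuous_fun) (continuous_trigActionGrad hH.continuous_grad) hL
    (trigAction_add_le hJ hH) ?_ ?_ hen' ?_ ?_ (by positivity) (by positivity) ?_ ?_
  · intro x
    ext k
    rw [hPa, hPa]
    split_ifs <;> simp
  · ext k
    rw [hPa, hea]
    split_ifs with h1 h2
    · lia
    · simp
    · simp
    · simp
  · exact fun y hy => trigAction_nonpos hH (hfix y hy)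
  · intro y t hy ht hρ
    refine (trigAction_le_of_high_eq_zero hJ hH fun k hk => ?_).trans ?_
    · simp [hfix y hy k (by lia), hea, hk.ne']
    have hye : inner ℝ y e = 0 := by
      rw [PiLp.inner_apply]
      refine Finset.sum_eq_zero fun k _ => ?_
      by_cases hk : (k : ℤ) = 1
      · rw [hfix y hy k (by lia), inner_zero_left]
      · rw [hea, if_neg hk, inner_zero_right]
    have h1 : ‖y + t • e‖ ^ 2 = ‖y‖ ^ 2 + t ^ 2 := by
      rw [norm_add_sq_real, inner_smul_right, hye, norm_smul, hen', Real.norm_of_nonneg ht]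
      ring
    have hb := hH.nonneg_b
    have h2 : (1 + b) ^ 2 ≤ ‖y‖ ^ 2 + t ^ 2 := by
      rcases le_max_iff.1 hρ with h2 | h2
      · nlinarith
      · nlinarith [sq_nonneg ‖y‖]
    rw [h1]
    nlinarith
  · intro x hx hxα
    rw [← hxα]
    exact le_trigAction_of_low_eq_zero hJ hH hK₀ hK1 (hker x hx) hxα.le
  · intro x hx
    obtain ⟨w, hw, hw2⟩ := le_inner_trigActionGrad hJ hH x
    by_contra! hlt
    have h1 := real_inner_le_norm (trigActionGrad J h x) w
    rw [hw] at h1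
    have h2 : ‖trigActionGrad J h x‖ * ‖x‖ ≤ 1 * ‖x‖ := by gcongr
    have h3 : B ^ 2 / (2 * Real.pi) ≤ B ^ 2 / 6 := by gcongr; linarith
    nlinarith [sq_nonneg B]

end galerkin

section limits
variable {E : Type*} [NormedAddCommGroup E]

theorem exists_tendsto_subseq_of_equicontinuous_periodic [ProperSpace E] {x : ℕ → ℝ → E}
    (hp : ∀ n t, x n (t + 1) = x n t) {M : ℝ} (hM : ∀ n t, ‖x n t‖ ≤ M) (heq : Equicontinuous x) :
    ∃ (y : ℝ → E) (φ : ℕ → ℕ), StrictMono φ ∧ Continuous y ∧ (∀ t, y (t + 1) = y t) ∧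
      ∀ t, Filter.Tendsto (fun n => x (φ n) t) Filter.atTop (𝓝 (y t)) := by
  have : Fact ((0 : ℝ) < 1) := ⟨one_pos⟩
  have hp' : ∀ n, Function.Periodic (x n) 1 := fun n t => hp n t
  have hc : ∀ n, Continuous (hp' n).lift := fun n => (heq.continuous n).quotient_lift _
  set X : ℕ → BoundedContinuousFunction (AddCircle (1 : ℝ)) E := fun n =>
    BoundedContinuousFunction.mkOfCompact ⟨(hp' n).lift, hc n⟩ with hX
  have hXx : ∀ n t, X n ((t : ℝ) : AddCircle (1 : ℝ)) = x n t := fun _ _ => rfl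
  have hcomp : IsCompact (closure (range X)) := by
    refine BoundedContinuousFunction.arzela_ascoli (closedBall (0 : E) M)
      (isCompact_closedBall _ _) _ ?_ ?_
    · rintro f q ⟨n, rfl⟩
      induction q using QuotientAddGroup.induction_on with
      | H t => simpa [hXx] using hM n t
    · intro q
      induction q using QuotientAddGroup.induction_on with
      | H t =>
        intro U hU
        have h1 := heq t U hU
        rw [QuotientAddGroup.nhds_eq, Filter.eventually_map]
        filter_upwards [h1] with s hs
        rintro ⟨f, n, rfl⟩
        exact hs n
  obtain ⟨Y, -, φ, hφ, hY⟩ := hcomp.tendsto_subseq fun n => subset_closure (mem_range_self n)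
  refine ⟨fun t => Y t, φ, hφ, Y.continuous.comp continuous_quotient_mk', fun t => ?_, fun t => ?_⟩
  · have : ((t + 1 : ℝ) : AddCircle (1 : ℝ)) = (t : AddCircle (1 : ℝ)) := by
      rw [AddCircle.coe_add, AddCircle.coe_period, add_zero]
    simp only [this]
  · exact (BoundedContinuousFunction.tendsto_iff_tendstoUniformly.1 hY).tendsto_at _

theorem tendsto_integral_of_bounded [NormedSpace ℝ E] {u : ℕ → ℝ → E} {v : ℝ → E}
    (hu : ∀ n, Continuous (u n)) {M : ℝ} (hM : ∀ n t, ‖u n t‖ ≤ M)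
    (huv : ∀ t, Filter.Tendsto (fun n => u n t) Filter.atTop (𝓝 (v t))) (a b : ℝ) :
    Filter.Tendsto (fun n => ∫ t in a..b, u n t) Filter.atTop (𝓝 (∫ t in a..b, v t)) := by
  refine tendsto_integral_filter_of_dominated_convergence (fun _ => M) ?_ ?_ (by simp) ?_
  · exact .of_forall fun n => (hu n).aestronglyMeasurable
  · exact .of_forall fun n => .of_forall fun t _ => hM n t
  · exact .of_forall fun t _ => huv t

end limits

section fourier

theorem eq_const_of_integral_cos_sin_eq_zero {p : ℝ → ℝ} (hp : Continuous p)
    (hper : ∀ t, p (t + 1) = p t)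
    (hcos : ∀ k : ℤ, k ≠ 0 → ∫ t in (0 : ℝ)..1, Real.cos (2 * Real.pi * k * t) * p t = 0)
    (hsin : ∀ k : ℤ, k ≠ 0 → ∫ t in (0 : ℝ)..1, Real.sin (2 * Real.pi * k * t) * p t = 0)
    (t s : ℝ) : p t = p s := by
  have : Fact ((0 : ℝ) < 1) := ⟨one_pos⟩
  have hp' : Function.Periodic p 1 := fun t => hper t
  set f : C(AddCircle (1 : ℝ), ℂ) :=
    ⟨fun q => (hp'.lift q : ℂ), Complex.continuous_ofReal.comp (hp.quotient_lift _)⟩ with hf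
  have hft : ∀ t : ℝ, f (t : AddCircle (1 : ℝ)) = (p t : ℂ) := fun t => rfl
  have h0 : ∀ k : ℤ, k ≠ 0 → fourierCoeff f k = 0 := by
    intro k hk
    rw [fourierCoeff_eq_intervalIntegral f k 0]
    have h1 : ∀ t : ℝ, (fourier (-k) (t : AddCircle (1 : ℝ)) : ℂ) • f (t : AddCircle (1 : ℝ)) =
        ((Real.cos (2 * Real.pi * k * t) * p t : ℝ) : ℂ) -
        ((Real.sin (2 * Real.pi * k * t) * p t : ℝ) : ℂ) * Complex.I := by
      intro t
      have e : 2 * (Real.pi : ℂ) * Complex.I * ((-k : ℤ) : ℂ) * (t : ℂ) / ((1 : ℝ) : ℂ) =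
          ((-(2 * Real.pi * k * t) : ℝ) : ℂ) * Complex.I := by
        push_cast; ring
      rw [fourier_coe_apply, hft, e, Complex.exp_mul_I, ← Complex.ofReal_cos,
        ← Complex.ofReal_sin, Real.cos_neg, Real.sin_neg, smul_eq_mul]
      push_cast
      ring
    simp_rw [h1]
    rw [zero_add, integral_sub ((by fun_prop : Continuous _).intervalIntegrable _ _)
      ((by fun_prop : Continuous _).intervalIntegrable _ _), intervalIntegral.integral_mul_const,
      intervalIntegral.integral_ofReal, intervalIntegral.integral_ofReal, hcos k hk, hsin k hk]
    simp
  have hsum : Summable (fourierCoeff f) := by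
    refine summable_of_ne_finset_zero (s := {0}) fun k hk => h0 k (by simpa using hk)
  have h2 : ∀ t : ℝ, (p t : ℂ) = fourierCoeff f 0 := by
    intro t
    have h3 := has_pointwise_sum_fourier_series_of_summable hsum (t : AddCircle (1 : ℝ))
    rw [hft] at h3
    refine h3.unique ?_
    convert hasSum_single (0 : ℤ) ?_ using 1
    · simp
    · intro k hk
      rw [h0 k hk, zero_smul]
  exact_mod_cast (h2 t).trans (h2 s).symm

variable {E : Type*} [NormedAddCommGroup E] [InnerProductSpace ℝ E] {J : E →L[ℝ] E}

theorem eq_const_of_trigCoeff_eq_zero [CompleteSpace E] (hJ : IsOrthogonalComplexStructure J)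
    {y : ℝ → E} (hy : Continuous y)
    (hper : ∀ t, y (t + 1) = y t) (h0 : ∀ k : ℤ, k ≠ 0 → trigCoeff J y k = 0) (t s : ℝ) :
    y t = y s := by
  have h1 : ∀ k : ℤ, trigCoeff J y k = (∫ t in (0 : ℝ)..1, Real.cos (2 * Real.pi * k * t) • y t) -
      J (∫ t in (0 : ℝ)..1, Real.sin (2 * Real.pi * k * t) • y t) := by
    intro k
    rw [← J.intervalIntegral_comp_comm ((by fun_prop : Continuous _).intervalIntegrable _ _),
      ← integral_sub ((by fun_prop : Continuous _).intervalIntegrable _ _)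
        ((by fun_prop : Continuous _).intervalIntegrable _ _)]
    refine integral_congr fun t _ => ?_
    simp only [rot, Real.cos_neg, Real.sin_neg, map_smul]
    module
  have h2 : ∀ k : ℤ, k ≠ 0 → (∫ t in (0 : ℝ)..1, Real.cos (2 * Real.pi * k * t) • y t) = 0 ∧
      (∫ t in (0 : ℝ)..1, Real.sin (2 * Real.pi * k * t) • y t) = 0 := by
    intro k hk
    have a1 := h1 k
    have a2 := h1 (-k)
    rw [h0 k hk] at a1
    rw [h0 (-k) (neg_ne_zero.2 hk)] at a2
    have e : ∀ t, 2 * Real.pi * ((-k : ℤ) : ℝ) * t = -(2 * Real.pi * k * t) := by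
      intro t; push_cast; ring
    simp only [e, Real.cos_neg, Real.sin_neg, neg_smul, intervalIntegral.integral_neg, map_neg] at a2
    set A := ∫ t in (0 : ℝ)..1, Real.cos (2 * Real.pi * k * t) • y t
    set B := ∫ t in (0 : ℝ)..1, Real.sin (2 * Real.pi * k * t) • y t
    have hA : A = 0 := by
      have : (2 : ℝ) • A = 0 := by
        calc (2 : ℝ) • A = (A - J B) + (A - -(J B)) := by module
          _ = 0 := by rw [← a1, ← a2, add_zero]
      simpa using this
    refine ⟨hA, ?_⟩
    rw [hA, zero_sub] at a1
    have : J B = 0 := neg_eq_zero.1 a1.symm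
    rw [← norm_eq_zero, ← hJ.norm_map, this, norm_zero]
  refine ext_inner_left ℝ fun v => ?_
  refine eq_const_of_integral_cos_sin_eq_zero (p := fun t => inner ℝ v (y t)) (by fun_prop)
    (fun t => by simp only [hper]) (fun k hk => ?_) (fun k hk => ?_) t s
  · have := (innerSL ℝ v).intervalIntegral_comp_comm (μ := volume) (a := 0) (b := 1)
      (f := fun t => Real.cos (2 * Real.pi * k * t) • y t)
      ((by fun_prop : Continuous _).intervalIntegrable _ _)
    simpa [(h2 k hk).1, inner_smul_right] using this
  · have := (innerSL ℝ v).intervalIntegral_comp_comm (μ := volume) (a := 0) (b := 1)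
      (f := fun t => Real.sin (2 * Real.pi * k * t) • y t)
      ((by fun_prop : Continuous _).intervalIntegrable _ _)
    simpa [(h2 k hk).2, inner_smul_right] using this

theorem hasDerivAt_of_trigCoeff_eq [CompleteSpace E] (hJ : IsOrthogonalComplexStructure J)
    {y w : ℝ → E} (hy : Continuous y) (hw : Continuous w)
    (hyper : ∀ t, y (t + 1) = y t) (hwper : ∀ t, w (t + 1) = w t)
    (hyw : ∀ k : ℤ, trigCoeff J w k = (2 * Real.pi * k) • trigCoeff J y k) (t : ℝ) :
    HasDerivAt y (J (w t)) t := by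
  set F : ℝ → E := fun t => ∫ τ in (0 : ℝ)..t, J (w τ) with hF
  have hJw : Continuous fun τ => J (w τ) := by fun_prop
  have hFd : ∀ t, HasDerivAt F (J (w t)) t := fun t =>
    (hJw.integral_hasStrictDerivAt 0 t).hasDerivAt
  have hFc : Continuous F := continuous_iff_continuousAt.2 fun t => (hFd t).continuousAt
  have hF0 : F 0 = 0 := by simp [hF]
  have hF1 : F 1 = 0 := by
    have h := hyw 0
    simp only [trigCoeff, Int.cast_zero, mul_zero, zero_mul, neg_zero, rot_zero, zero_smul] at h
    simp only [hF]
    rw [J.intervalIntegral_comp_comm (hw.intervalIntegrable _ _), h, map_zero]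
  have hFper : ∀ t, F (t + 1) = F t := by
    intro t
    have h1 : F (t + 1) = F t + ∫ τ in t..t + 1, J (w τ) :=
      (integral_add_adjacent_intervals (hJw.intervalIntegrable _ _)
        (hJw.intervalIntegrable _ _)).symm
    have h2 : Function.Periodic (fun τ => J (w τ)) 1 := fun τ => by simp only [hwper]
    rw [h1, h2.intervalIntegral_add_eq t 0, zero_add]
    exact add_eq_left.2 hF1
  have hcoef : ∀ k : ℤ, k ≠ 0 → trigCoeff J (fun t => y t - F t) k = 0 := by
    intro k hk
    have h1 : ∀ t, HasDerivAt (fun t => rot J (-(2 * Real.pi * k * t)) (F t))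
        (rot J (-(2 * Real.pi * k * t)) (J (w t)) -
          J (rot J (-(2 * Real.pi * k * t)) ((2 * Real.pi * k) • F t))) t := by
      intro t
      have a1 : HasDerivAt (fun t : ℝ => -(2 * Real.pi * k * t)) (-(2 * Real.pi * k)) t := by
        simpa using ((hasDerivAt_id t).const_mul (2 * Real.pi * k)).fun_neg
      have a2 := (a1.cos.smul (hFd t)).add
        (a1.sin.smul (J.hasFDerivAt.comp_hasDerivAt t (hFd t)))
      refine a2.congr_deriv ?_
      simp only [rot, map_add, map_smul, hJ.sq, Function.comp_apply]
      module
    have h2 := integral_eq_sub_of_hasDerivAt (a := 0) (b := 1) (fun t _ => h1 t)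
      ((by fun_prop : Continuous _).intervalIntegrable _ _)
    rw [hF0, hF1] at h2
    have hrot0 : ∀ θ, rot J θ (0 : E) = 0 := fun θ => by simp [rot]
    have hrotJ : ∀ θ (x : E), rot J θ (J x) = J (rot J θ x) := fun θ x => by simp [rot]
    simp only [hrot0, sub_zero, hrotJ, rot_smul, map_smul] at h2
    rw [integral_sub ((by fun_prop : Continuous _).intervalIntegrable _ _)
        ((by fun_prop : Continuous _).intervalIntegrable _ _), intervalIntegral.integral_smul,
      J.intervalIntegral_comp_comm ((by fun_prop : Continuous _).intervalIntegrable _ _),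
      J.intervalIntegral_comp_comm ((by fun_prop : Continuous _).intervalIntegrable _ _)] at h2
    change J (trigCoeff J w k) - (2 * Real.pi * k) • J (trigCoeff J F k) = 0 at h2
    have h3 : trigCoeff J (fun t => y t - F t) k = trigCoeff J y k - trigCoeff J F k := by
      rw [trigCoeff, trigCoeff, trigCoeff,
        ← integral_sub ((by fun_prop : Continuous _).intervalIntegrable _ _)
        ((by fun_prop : Continuous _).intervalIntegrable _ _)]
      refine integral_congr fun t _ => ?_
      simp only [rot, map_sub]
      module
    rw [hyw, map_smul, ← smul_sub, ← map_sub, ← h3] at h2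
    have h4 : (2 * Real.pi * k : ℝ) ≠ 0 := by
      have : (k : ℝ) ≠ 0 := by exact_mod_cast hk
      positivity
    have h5 := (smul_eq_zero.1 h2).resolve_left h4
    rw [← norm_eq_zero, ← hJ.norm_map, h5, norm_zero]
  have hconst := eq_const_of_trigCoeff_eq_zero hJ (hy.sub hFc)
    (fun t => by simp only [Pi.sub_apply, hyper, hFper]) hcoef
  have hyF : y = fun t => F t + (y 0 - F 0) := by
    funext t
    have := hconst t 0
    simp only [Pi.sub_apply] at this
    rw [← this]; abel
  rw [hyF]
  have := (hFd t).add_const (y 0 - F 0)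
  rw [← hyF]
  convert this using 1

end fourier

/-- There is a `1`-periodic orbit of `J h` with action at least `β` (with respect to `H`). -/
def HasActionOrbit {E : Type*} [NormedAddCommGroup E] [InnerProductSpace ℝ E] (J : E →L[ℝ] E)
    (H : E → ℝ) (h : E → E) (β : ℝ) : Prop :=
  ∃ x : ℝ → E, (∀ t, x (t + 1) = x t) ∧ (∀ t, HasDerivAt x (J (h (x t))) t) ∧
    β ≤ ∫ t in (0 : ℝ)..1, (1 / 2 * inner ℝ (h (x t)) (x t) - H (x t))

section galerkin
variable {E : Type*} [NormedAddCommGroup E] [InnerProductSpace ℝ E] {J : E →L[ℝ] E}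
  {s : Finset ℤ} {H : E → ℝ} {h : E → E} {K r C b B : ℝ} {c : TrigCoeff E s}

theorem trigCoeff_of_trigActionGrad_eq_zero (hc : trigActionGrad J h c = 0) (k : s) :
    trigCoeff J (fun t => h (trig J c t)) k = (2 * Real.pi * (k : ℤ)) • c k := by
  have : trigActionGrad J h c k = 0 := by rw [hc]; rfl
  exact (sub_eq_zero.1 this).symm

theorem trigAction_of_trigActionGrad_eq_zero [CompleteSpace E]
    (hJ : IsOrthogonalComplexStructure J)
    (hH : IsAsymptoticallyQuadratic H h K r C b B) (hc : trigActionGrad J h c = 0) :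
    trigAction J H c =
      ∫ t in (0 : ℝ)..1, (1 / 2 * inner ℝ (h (trig J c t)) (trig J c t) - H (trig J c t)) := by
  have hHc := hH.continuous_fun
  have hh := hH.continuous_grad
  rw [integral_sub ((by fun_prop : Continuous _).intervalIntegrable _ _)
    ((by fun_prop : Continuous _).intervalIntegrable _ _), intervalIntegral.integral_const_mul,
    integral_inner_trig hJ (by fun_prop), trigAction, Finset.mul_sum]
  congr 1
  refine Finset.sum_congr rfl fun k _ => ?_
  rw [trigCoeff_of_trigActionGrad_eq_zero hc, inner_smul_left, real_inner_self_eq_norm_sq]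
  simp
  ring

theorem norm_sq_le_of_trigActionGrad_eq_zero [CompleteSpace E]
    (hJ : IsOrthogonalComplexStructure J)
    (hH : IsAsymptoticallyQuadratic H h K r C b B) (hc : trigActionGrad J h c = 0) :
    ‖c‖ ^ 2 ≤ B ^ 2 := by
  obtain ⟨w, -, hw⟩ := le_inner_trigActionGrad hJ hH c
  rw [hc, inner_zero_left] at hw
  have hpi := Real.pi_gt_three
  have h3 : B ^ 2 / (2 * Real.pi) ≤ B ^ 2 / 6 := by gcongr; linarith
  nlinarith [sq_nonneg B, sq_nonneg ‖c‖]

theorem norm_deriv_sq_le_of_trigActionGrad_eq_zero [CompleteSpace E]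
    (hJ : IsOrthogonalComplexStructure J)
    (hH : IsAsymptoticallyQuadratic H h K r C b B) (hc : trigActionGrad J h c = 0) :
    ‖trigMul (fun k => 2 * Real.pi * k) c‖ ^ 2 ≤ 182 * B ^ 2 := by
  have hh := hH.continuous_grad
  set d : TrigCoeff E s := trigMul (fun k => 2 * Real.pi * k) c with hd
  have h1 : ‖d‖ ^ 2 = ∫ t in (0 : ℝ)..1, inner ℝ (h (trig J c t)) (trig J d t) := by
    rw [integral_inner_trig hJ (by fun_prop), TrigCoeff.norm_sq]
    refine Finset.sum_congr rfl fun k _ => ?_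
    rw [trigCoeff_of_trigActionGrad_eq_zero hc, ← real_inner_self_eq_norm_sq]
    rfl
  have h2 : ∫ t in (0 : ℝ)..1, inner ℝ (h (trig J c t)) (trig J d t) ≤
      B ^ 2 + 90 * ‖c‖ ^ 2 + 1 / 2 * ‖d‖ ^ 2 := by
    rw [← integral_norm_trig_sq hJ, ← integral_norm_trig_sq hJ]
    have : B ^ 2 = ∫ t in (0 : ℝ)..1, B ^ 2 := by simp
    rw [this, ← intervalIntegral.integral_const_mul, ← intervalIntegral.integral_const_mul,
      ← integral_add ((by fun_prop : Continuous _).intervalIntegrable _ _)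
        ((by fun_prop : Continuous _).intervalIntegrable _ _),
      ← integral_add ((by fun_prop : Continuous _).intervalIntegrable _ _)
        ((by fun_prop : Continuous _).intervalIntegrable _ _)]
    refine integral_le_integral_of_continuous (by fun_prop) (by fun_prop) fun t => ?_
    set x := trig J c t
    set y := trig J d t
    have e1 := real_inner_le_norm (h x) y
    have e2 : ‖h x‖ ^ 2 ≤ 2 * B ^ 2 + 180 * ‖x‖ ^ 2 := by
      have h3 := norm_le_norm_sub_add (h x) ((3 * Real.pi) • x)
      rw [norm_smul, Real.norm_of_nonneg (by positivity)] at h3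
      have h4 := hH.norm_grad_sub_le x
      have h5 := Real.pi_lt_d2
      have h6 := Real.pi_pos
      have h7 : ‖h x‖ ≤ B + (3 * Real.pi) * ‖x‖ := by linarith
      have h8 : ‖h x‖ ^ 2 ≤ (B + (3 * Real.pi) * ‖x‖) ^ 2 := by gcongr
      have h9 : (3 * Real.pi) ^ 2 ≤ 90 := by nlinarith
      have h10 : (3 * Real.pi) ^ 2 * ‖x‖ ^ 2 ≤ 90 * ‖x‖ ^ 2 := by gcongr
      nlinarith [sq_nonneg (B - (3 * Real.pi) * ‖x‖)]
    nlinarith [sq_nonneg (‖h x‖ - ‖y‖)]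
  have h3 := norm_sq_le_of_trigActionGrad_eq_zero hJ hH hc
  linarith

theorem norm_trig_sub_le_of_trigActionGrad_eq_zero [CompleteSpace E]
    (hJ : IsOrthogonalComplexStructure J)
    (hH : IsAsymptoticallyQuadratic H h K r C b B) (hc : trigActionGrad J h c = 0) {t u : ℝ}
    (htu : t ≤ u) (hut : u ≤ t + 1) {l : ℝ} (hl : 0 < l) :
    ‖trig J c u - trig J c t‖ ≤ l * (u - t) + 182 * B ^ 2 / l := by
  set d : TrigCoeff E s := trigMul (fun k => 2 * Real.pi * k) c with hd
  have h1 : ∫ τ in t..u, J (trig J d τ) = trig J c u - trig J c t :=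
    integral_eq_sub_of_hasDerivAt (fun τ _ => hasDerivAt_trig hJ c τ)
      ((by fun_prop : Continuous _).intervalIntegrable _ _)
  have h2 : ‖∫ τ in t..u, J (trig J d τ)‖ ≤ ∫ τ in t..u, (l + 1 / l * ‖trig J d τ‖ ^ 2) := by
    refine norm_integral_le_of_norm_le htu (.of_forall fun τ _ => ?_)
      ((by fun_prop : Continuous _).intervalIntegrable _ _)
    rw [hJ.norm_map]
    set v := ‖trig J d τ‖
    have : 0 ≤ v := norm_nonneg _
    rcases le_total v l with hv | hv
    · have : 0 ≤ 1 / l * v ^ 2 := by positivity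
      linarith
    · have : v ≤ 1 / l * v ^ 2 := by
        rw [div_mul_eq_mul_div, one_mul, le_div_iff₀ hl]; nlinarith
      linarith
  have hcont : Continuous fun τ => ‖trig J d τ‖ ^ 2 := by fun_prop
  have h3 : ∫ τ in t..u, ‖trig J d τ‖ ^ 2 ≤ ‖d‖ ^ 2 := by
    have hper : Function.Periodic (fun τ => ‖trig J d τ‖ ^ 2) 1 := fun τ => by
      simp only [trig_periodic]
    rw [← integral_norm_trig_sq hJ]
    have h4 := hper.intervalIntegral_add_eq t 0
    rw [zero_add] at h4
    rw [← h4]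
    exact integral_mono_interval le_rfl htu hut (.of_forall fun τ => by positivity)
      (hcont.intervalIntegrable _ _)
  have h4 := norm_deriv_sq_le_of_trigActionGrad_eq_zero hJ hH hc
  rw [← h1]
  refine h2.trans ?_
  rw [integral_add (by simp) ((by fun_prop : Continuous _).intervalIntegrable _ _),
    intervalIntegral.integral_const_mul, intervalIntegral.integral_const, smul_eq_mul]
  have h5 : 1 / l * ∫ τ in t..u, ‖trig J d τ‖ ^ 2 ≤ 1 / l * (182 * B ^ 2) := by
    gcongr
    exact h3.trans h4
  have : 1 / l * (182 * B ^ 2) = 182 * B ^ 2 / l := by ring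
  linarith

theorem norm_trig_le_of_trigActionGrad_eq_zero [CompleteSpace E]
    (hJ : IsOrthogonalComplexStructure J)
    (hH : IsAsymptoticallyQuadratic H h K r C b B) (hc : trigActionGrad J h c = 0) (t : ℝ) :
    ‖trig J c t‖ ≤ 2 * B ^ 2 + 2 * (1 + 182 * B ^ 2) ^ 2 + 1 := by
  set D := 1 + 182 * B ^ 2 with hD
  have hcont : Continuous fun τ => ‖trig J c τ‖ ^ 2 := by fun_prop
  have h1 : ‖trig J c t‖ ^ 2 ≤ 2 * B ^ 2 + 2 * D ^ 2 := by
    have hper : Function.Periodic (fun τ => ‖trig J c τ‖ ^ 2) 1 := fun τ => by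
      simp only [trig_periodic]
    have h4 := hper.intervalIntegral_add_eq t 0
    rw [zero_add, integral_norm_trig_sq hJ] at h4
    have h2 : ∫ τ in t..t + 1, ‖trig J c t‖ ^ 2 ≤
        ∫ τ in t..t + 1, (2 * ‖trig J c τ‖ ^ 2 + 2 * D ^ 2) := by
      refine integral_mono_on (by linarith) (by simp)
        ((by fun_prop : Continuous _).intervalIntegrable _ _) fun τ hτ => ?_
      have h5 := norm_trig_sub_le_of_trigActionGrad_eq_zero hJ hH hc hτ.1 hτ.2 one_pos
      have h6 : ‖trig J c t‖ ≤ ‖trig J c τ‖ + D := by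
        have := norm_le_norm_add_norm_sub (trig J c τ) (trig J c t)
        have := hτ.2
        rw [norm_sub_rev] at h5
        simp only [div_one] at h5
        rw [norm_sub_rev] at h5
        linarith
      have h7 : ‖trig J c t‖ ^ 2 ≤ (‖trig J c τ‖ + D) ^ 2 := by gcongr
      nlinarith [sq_nonneg (‖trig J c τ‖ - D)]
    rw [integral_add ((by fun_prop : Continuous _).intervalIntegrable _ _) (by simp),
      intervalIntegral.integral_const_mul, h4] at h2
    simp only [intervalIntegral.integral_const, smul_eq_mul, add_sub_cancel_left, one_mul] at h2
    have := norm_sq_le_of_trigActionGrad_eq_zero hJ hH hc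
    linarith
  nlinarith [sq_nonneg (‖trig J c t‖ - 1)]

/-- An asymptotically quadratic Hamiltonian has a periodic orbit whose action is bounded below
in terms of the constants `C` and `r` only. -/
theorem IsAsymptoticallyQuadratic.hasActionOrbit [FiniteDimensional ℝ E] [Nontrivial E]
    (hJ : IsOrthogonalComplexStructure J) {K₀ : ℕ} (hK₀ : 8 * C / Real.pi ≤ K₀) (hK1 : 1 ≤ K₀)
    (hH : IsAsymptoticallyQuadratic H h K r C b B) :
    HasActionOrbit J H h (Real.pi / 4 * (r / (2 * K₀)) ^ 2) := by
  have : CompleteSpace E := FiniteDimensional.complete ℝ E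
  have : ProperSpace E := FiniteDimensional.proper ℝ E
  have hHc := hH.continuous_fun
  have hh := hH.continuous_grad
  have hex : ∀ N : ℕ, ∃ c : TrigCoeff E (Finset.Icc (-(N + 1) : ℤ) (N + 1)),
      trigActionGrad J h c = 0 ∧ Real.pi / 4 * (r / (2 * K₀)) ^ 2 ≤ trigAction J H c := fun N =>
    exists_trigActionGrad_eq_zero hJ hK₀ hK1 hH (by simp; lia)
  choose c hc hact using hex
  set M := 2 * B ^ 2 + 2 * (1 + 182 * B ^ 2) ^ 2 + 1 with hM
  have hbd : ∀ N t, ‖trig J (c N) t‖ ≤ M := fun N t =>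
    norm_trig_le_of_trigActionGrad_eq_zero hJ hH (hc N) t
  have hcont : ∀ N, Continuous (trig J (c N)) := fun N => by fun_prop
  have heq : Equicontinuous fun N => trig J (c N) := by
    intro t
    rw [Metric.equicontinuousAt_iff_right]
    intro ε hε
    set l := 2 * (182 * B ^ 2 + 1) / ε with hl
    have hl0 : 0 < l := by positivity
    have hδ : 0 < min 1 (ε / (2 * l)) := by positivity
    filter_upwards [ball_mem_nhds t hδ] with u hu N
    rw [mem_ball, Real.dist_eq, lt_min_iff, lt_div_iff₀ (by positivity)] at hu
    have h2 : 182 * B ^ 2 / l < ε / 2 := by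
      rw [div_lt_iff₀ hl0, hl]
      field_simp
      linarith
    have h3 : ‖trig J (c N) t - trig J (c N) u‖ ≤ l * |u - t| + 182 * B ^ 2 / l := by
      rcases le_total t u with htu | htu
      · rw [norm_sub_rev, abs_of_nonneg (sub_nonneg.2 htu)]
        rw [abs_of_nonneg (sub_nonneg.2 htu)] at hu
        exact norm_trig_sub_le_of_trigActionGrad_eq_zero hJ hH (hc N) htu (by linarith) hl0
      · rw [abs_sub_comm, abs_of_nonneg (sub_nonneg.2 htu)]
        rw [abs_sub_comm, abs_of_nonneg (sub_nonneg.2 htu)] at hu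
        exact norm_trig_sub_le_of_trigActionGrad_eq_zero hJ hH (hc N) htu (by linarith) hl0
    rw [dist_eq_norm]
    nlinarith
  obtain ⟨y, φ, hφ, hyc, hyp, hlim⟩ := exists_tendsto_subseq_of_equicontinuous_periodic
    (fun N t => trig_periodic (c N) t) hbd heq
  have hgrow : ∀ x : E, ‖x‖ ≤ M → ‖h x‖ ≤ B + 3 * Real.pi * M := by
    intro x hx
    have h3 := norm_le_norm_sub_add (h x) ((3 * Real.pi) • x)
    rw [norm_smul, Real.norm_of_nonneg (by positivity)] at h3
    have h4 := hH.norm_grad_sub_le x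
    have h5 : 3 * Real.pi * ‖x‖ ≤ 3 * Real.pi * M := by gcongr
    linarith
  have hlimh : ∀ t, Filter.Tendsto (fun n => h (trig J (c (φ n)) t)) Filter.atTop (𝓝 (h (y t))) :=
    fun t => (hh.tendsto _).comp (hlim t)
  refine ⟨y, hyp, ?_, ?_⟩
  · refine hasDerivAt_of_trigCoeff_eq hJ hyc (hh.comp hyc) hyp
      (fun t => by simp only [hyp]) fun k => ?_
    have hrotc : ∀ θ, Continuous fun x : E => rot J θ x := fun θ => by fun_prop
    have t1 : Filter.Tendsto (fun n => trigCoeff J (fun t => h (trig J (c (φ n)) t)) k)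
        Filter.atTop (𝓝 (trigCoeff J (h ∘ y) k)) := by
      refine tendsto_integral_of_bounded (M := B + 3 * Real.pi * M) (fun n => by fun_prop)
        (fun n t => ?_) (fun t => ((hrotc _).tendsto _).comp (hlimh t)) 0 1
      exact (hJ.norm_rot _ _).trans_le (hgrow _ (hbd _ _))
    have t2 : Filter.Tendsto (fun n => trigCoeff J (trig J (c (φ n))) k)
        Filter.atTop (𝓝 (trigCoeff J y k)) := by
      refine tendsto_integral_of_bounded (M := M) (fun n => by fun_prop)
        (fun n t => ?_) (fun t => ((hrotc _).tendsto _).comp (hlim t)) 0 1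
      exact (hJ.norm_rot _ _).trans_le (hbd _ _)
    refine tendsto_nhds_unique t1 ((t2.const_smul _).congr' ?_)
    filter_upwards [Filter.eventually_ge_atTop k.natAbs] with n hn
    have hn' := hφ.id_le n
    simp only [id] at hn'
    have hk : k ∈ Finset.Icc (-((φ n : ℕ) + 1) : ℤ) ((φ n : ℕ) + 1) := by
      rw [Finset.mem_Icc]
      lia
    have e1 := trigCoeff_of_trigActionGrad_eq_zero (hc (φ n)) ⟨k, hk⟩
    have e2 := trigCoeff_trig hJ (c (φ n)) ⟨k, hk⟩
    simp only at e1 e2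
    rw [e1, e2]
  · refine ge_of_tendsto' (x := Filter.atTop) (tendsto_integral_of_bounded
      (u := fun n t => 1 / 2 * inner ℝ (h (trig J (c (φ n)) t)) (trig J (c (φ n)) t) -
        H (trig J (c (φ n)) t)) (M := 1 / 2 * ((B + 3 * Real.pi * M) * M) + C * M ^ 2)
        (fun n => by fun_prop) (fun n t => ?_) (fun t => ?_) 0 1) fun n => ?_
    · set x := trig J (c (φ n)) t
      have hx : ‖x‖ ≤ M := hbd _ _
      have hhx := hgrow x hx
      have e1 := abs_real_inner_le_norm (h x) x
      have e2 : ‖h x‖ * ‖x‖ ≤ (B + 3 * Real.pi * M) * M := by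
        have := norm_nonneg (h x)
        gcongr
        linarith
      have e3 := hH.nonneg x
      have e4 := hH.le_sq x
      have e5 : C * ‖x‖ ^ 2 ≤ C * M ^ 2 := by
        have := hH.nonneg_C
        gcongr
      rw [Real.norm_eq_abs]
      rw [abs_le] at e1 ⊢
      constructor <;> linarith [e1.1, e1.2]
    · exact (((hlimh t).inner (hlim t)).const_mul _).sub ((hHc.tendsto _).comp (hlim t))
    · rw [← trigAction_of_trigActionGrad_eq_zero hJ hH (hc (φ n))]
      exact hact _

end galerkin

/-- A primitive of `Real.smoothTransition`: a smooth version of the positive part. -/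
noncomputable def smoothPos (s : ℝ) : ℝ := ∫ u in (0 : ℝ)..s, Real.smoothTransition u

theorem hasDerivAt_smoothPos (s : ℝ) : HasDerivAt smoothPos (Real.smoothTransition s) s :=
  (Real.smoothTransition.continuous.integral_hasStrictDerivAt 0 s).hasDerivAt

theorem smoothPos_of_nonpos {s : ℝ} (hs : s ≤ 0) : smoothPos s = 0 := by
  rw [smoothPos, integral_symm, neg_eq_zero]
  refine (integral_congr fun u hu => ?_).trans integral_zero
  rw [uIcc_of_le hs] at hu
  exact Real.smoothTransition.zero_of_nonpos hu.2

theorem smoothPos_nonneg (s : ℝ) : 0 ≤ smoothPos s := by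
  rcases le_total s 0 with hs | hs
  · rw [smoothPos_of_nonpos hs]
  · exact integral_nonneg hs fun u _ => Real.smoothTransition.nonneg u

theorem smoothPos_pos {s : ℝ} (hs : 0 < s) : 0 < smoothPos s :=
  intervalIntegral_pos_of_pos_on (Real.smoothTransition.continuous.intervalIntegrable _ _)
    (fun _ hu => Real.smoothTransition.pos_of_pos hu.1) hs

theorem smoothPos_le {s : ℝ} (hs : 0 ≤ s) : smoothPos s ≤ s := by
  have : smoothPos s ≤ ∫ u in (0 : ℝ)..s, (1 : ℝ) :=
    integral_mono hs (Real.smoothTransition.continuous.intervalIntegrable _ _) (by simp)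
      fun u => Real.smoothTransition.le_one u
  simpa using this

theorem sub_one_le_smoothPos (s : ℝ) : s - 1 ≤ smoothPos s := by
  rcases le_total s 1 with hs | hs
  · linarith [smoothPos_nonneg s]
  · have h1 : smoothPos s = smoothPos 1 + ∫ u in (1 : ℝ)..s, Real.smoothTransition u :=
      (integral_add_adjacent_intervals (Real.smoothTransition.continuous.intervalIntegrable _ _)
        (Real.smoothTransition.continuous.intervalIntegrable _ _)).symm
    have h2 : ∫ u in (1 : ℝ)..s, Real.smoothTransition u = ∫ u in (1 : ℝ)..s, (1 : ℝ) := by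
      refine integral_congr fun u hu => ?_
      rw [uIcc_of_le hs] at hu
      exact Real.smoothTransition.one_of_one_le hu.1
    rw [h1, h2]
    simpa using smoothPos_nonneg 1

section cutoff
variable {E : Type*} [NormedAddCommGroup E] [InnerProductSpace ℝ E] {J : E →L[ℝ] E}

/-- `h` is the gradient of `H`. -/
def IsGradientOf (H : E → ℝ) (h : E → E) : Prop := ∀ z, HasFDerivAt H (innerSL ℝ (h z)) z

theorem IsGradientOf.comp {H : E → ℝ} {h : E → E} (hH : IsGradientOf H h) {x : ℝ → E} {x' : E}
    {t : ℝ} (hx : HasDerivAt x x' t) :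
    HasDerivAt (fun t => H (x t)) (inner ℝ (h (x t)) x') t :=
  (hH (x t)).comp_hasDerivAt t hx

theorem IsGradientOf.descent {H : E → ℝ} {h : E → E} (hH : IsGradientOf H h) {L : NNReal}
    (hL : LipschitzWith L h) (z w : E) :
    H z + inner ℝ (h z) w - L * ‖w‖ ^ 2 ≤ H (z + w) := by
  have hline : ∀ t : ℝ, HasDerivAt (fun t : ℝ => z + t • w) w t := fun t => by
    simpa using ((hasDerivAt_id t).smul_const w).const_add z
  have hφ : ∀ t : ℝ, HasDerivAt (fun t : ℝ => H (z + t • w)) (inner ℝ (h (z + t • w)) w) t :=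
    fun t => hH.comp (hline t)
  obtain ⟨t, ht, hmv⟩ := exists_hasDerivAt_eq_slope (fun t : ℝ => H (z + t • w)) _ zero_lt_one
    (fun t _ => (hφ t).continuousAt.continuousWithinAt) fun t _ => hφ t
  simp only [one_smul, zero_smul, add_zero, sub_zero, div_one] at hmv
  have h1 : inner ℝ (h (z + t • w)) w = inner ℝ (h z) w + inner ℝ (h (z + t • w) - h z) w := by
    rw [← inner_add_left, add_sub_cancel]
  have h2 := abs_real_inner_le_norm (h (z + t • w) - h z) w
  have h3 := hL.norm_sub_le (z + t • w) z
  rw [add_sub_cancel_left, norm_smul, Real.norm_of_nonneg ht.1.le] at h3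
  have h4 : ‖h (z + t • w) - h z‖ ≤ L * (1 * ‖w‖) := h3.trans (by gcongr; exact ht.2.le)
  have h5 : ‖h (z + t • w) - h z‖ * ‖w‖ ≤ L * (1 * ‖w‖) * ‖w‖ := by gcongr
  rw [abs_le] at h2
  nlinarith [h2.1]

theorem IsGradientOf.eq_zero_of_max {H : E → ℝ} {h : E → E} (hH : IsGradientOf H h) {z : E}
    (hz : ∀ w, H w ≤ H z) : h z = 0 := by
  have h1 := (IsLocalMax.hasFDerivAt_eq_zero (.of_forall hz) (hH z) : innerSL ℝ (h z) = 0)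
  have h2 : inner ℝ (h z) (h z) = 0 := by
    simpa using congrArg (fun l => l (h z)) h1
  exact inner_self_eq_zero.1 h2

theorem isGradientOf_smoothPos (a R : ℝ) :
    IsGradientOf (fun z : E => a * smoothPos (‖z‖ ^ 2 - R ^ 2))
      (fun z => (2 * a * Real.smoothTransition (‖z‖ ^ 2 - R ^ 2)) • z) := by
  intro z
  have h1 : HasFDerivAt (fun z : E => ‖z‖ ^ 2 - R ^ 2) (2 • innerSL ℝ z) z :=
    (hasStrictFDerivAt_norm_sq z).hasFDerivAt.sub_const _
  have h2 := ((hasDerivAt_smoothPos (‖z‖ ^ 2 - R ^ 2)).comp_hasFDerivAt z h1).const_mul a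
  refine h2.congr_fderiv ?_
  ext w
  simp
  ring

theorem exists_lipschitzWith_cutoff [FiniteDimensional ℝ E] {R : ℝ} (hR : 0 < R) :
    ∃ L, LipschitzWith L
      fun z : E => (1 - Real.smoothTransition (‖z‖ ^ 2 - R ^ 2)) • z := by
  refine ContDiff.lipschitzWith_of_hasCompactSupport (𝕂 := ℝ) (n := 1) ?_ ?_ one_ne_zero
  · have : ProperSpace E := FiniteDimensional.proper ℝ E
    refine HasCompactSupport.intro (isCompact_closedBall (0 : E) (R + 1)) fun z hz => ?_
    rw [mem_closedBall_zero_iff, not_le] at hz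
    rw [Real.smoothTransition.one_of_one_le (by nlinarith), sub_self, zero_smul]
  · exact (contDiff_const.sub (Real.smoothTransition.contDiff.comp
      ((contDiff_norm_sq ℝ).sub contDiff_const))).smul contDiff_id

theorem norm_cutoff_le {R : ℝ} (hR : 0 < R) (z : E) :
    ‖(1 - Real.smoothTransition (‖z‖ ^ 2 - R ^ 2)) • z‖ ≤ R + 1 := by
  have h0 := Real.smoothTransition.nonneg (‖z‖ ^ 2 - R ^ 2)
  have h1 := Real.smoothTransition.le_one (‖z‖ ^ 2 - R ^ 2)
  rw [norm_smul, Real.norm_of_nonneg (by linarith)]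
  rcases le_or_gt ‖z‖ (R + 1) with hz | hz
  · nlinarith [norm_nonneg z]
  · rw [Real.smoothTransition.one_of_one_le (by nlinarith), sub_self, zero_mul]
    linarith

/-- Compactly supported oscillation forces periodic orbits: a Hamiltonian vanishing on the ball of
radius `r` and equal to a large constant outside the ball of radius `R` has a `1`-periodic
orbit of positive action. -/
theorem exists_hasActionOrbit_of_oscillation [FiniteDimensional ℝ E] [Nontrivial E]
    (hJ : IsOrthogonalComplexStructure J) {r R : ℝ} (hr : 0 < r) (hrR : r ≤ R) :
    ∃ β > 0, ∀ (H : E → ℝ) (h : E → E) (m : ℝ), IsGradientOf H h → (∃ L, LipschitzWith L h) →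
      (∀ z, 0 ≤ H z) → (∀ z, H z ≤ m) → (∀ z, ‖z‖ ≤ r → H z = 0) → (∀ z, R ≤ ‖z‖ → H z = m) →
      3 * Real.pi / 2 * (R ^ 2 + 1) ≤ m → m ≤ 3 * Real.pi / 2 * (R ^ 2 + 1) + 1 →
      HasActionOrbit J H h β := by
  have hR : 0 < R := hr.trans_le hrR
  have hpi := Real.pi_pos
  set a := 3 * Real.pi / 2 with ha
  have ha0 : 0 < a := by positivity
  set C := (a * (R ^ 2 + 1) + 1) / r ^ 2 + a with hC
  set K₀ : ℕ := ⌈8 * C / Real.pi⌉₊ + 1 with hK₀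
  refine ⟨Real.pi / 4 * (r / (2 * K₀)) ^ 2, by positivity, ?_⟩
  rintro H h m hg ⟨L, hL⟩ hH0 hHm hHr hHR hmC hmC'
  obtain ⟨L', hL'⟩ := exists_lipschitzWith_cutoff (E := E) hR
  set σ : E → ℝ := fun z => Real.smoothTransition (‖z‖ ^ 2 - R ^ 2) with hσ
  set H' : E → ℝ := fun z => H z + a * smoothPos (‖z‖ ^ 2 - R ^ 2) with hH'
  set h' : E → E := fun z => h z + (2 * a * σ z) • z with hh'
  have hh0 : ∀ z, R ≤ ‖z‖ → h z = 0 := fun z hz =>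
    hg.eq_zero_of_max fun w => (hHm w).trans_eq (hHR z hz).symm
  have hg' : IsGradientOf H' h' := fun z => by
    refine ((hg z).add (isGradientOf_smoothPos a R z)).congr_fderiv ?_
    rw [hh', map_add]
  have hcut : ∀ z, h' z = h z + ((2 * a) • z - (2 * a) • ((1 - σ z) • z)) := fun z => by
    simp only [hh']; module
  have hLip : LipschitzWith (L + (‖2 * a‖₊ + ‖2 * a‖₊ * L')) h' := by
    rw [show h' = fun z => h z + ((2 * a) • z - (2 * a) • ((1 - σ z) • z)) from funext hcut]
    refine hL.add (LipschitzWith.sub ?_ ?_)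
    · exact lipschitzWith_smul (2 * a)
    · exact (lipschitzWith_smul (2 * a)).comp hL'
  have hin : ∀ z : E, ‖z‖ ≤ R → ‖z‖ ^ 2 - R ^ 2 ≤ 0 := fun z hz => by
    nlinarith [norm_nonneg z]
  have hAQ : IsAsymptoticallyQuadratic H' h' (L + (‖2 * a‖₊ + ‖2 * a‖₊ * L') : NNReal) r C
      (a * (R ^ 2 + 1)) (‖h 0‖ + L * R + 2 * a * (R + 1)) :=
    { continuous_fun := continuous_iff_continuousAt.2 fun z => (hg' z).continuousAt
      continuous_grad := hLip.continuous
      nonneg_K := NNReal.coe_nonneg _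
      descent := hg'.descent hLip
      nonneg := fun z => add_nonneg (hH0 z) (mul_nonneg ha0.le (smoothPos_nonneg _))
      pos_r := hr
      eq_zero := fun z hz => by
        simp only [hH', hHr z hz, smoothPos_of_nonpos (hin z (hz.trans hrR)), mul_zero, add_zero]
      nonneg_C := by positivity
      le_sq := fun z => by
        have h1 : H z ≤ (a * (R ^ 2 + 1) + 1) / r ^ 2 * ‖z‖ ^ 2 := by
          rcases le_total ‖z‖ r with hz | hz
          · rw [hHr z hz]; positivity
          · calc H z ≤ a * (R ^ 2 + 1) + 1 := (hHm z).trans hmC'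
              _ = (a * (R ^ 2 + 1) + 1) / r ^ 2 * r ^ 2 := by field_simp
              _ ≤ _ := by gcongr
        have h2 : smoothPos (‖z‖ ^ 2 - R ^ 2) ≤ ‖z‖ ^ 2 := by
          rcases le_total (‖z‖ ^ 2 - R ^ 2) 0 with hz | hz
          · rw [smoothPos_of_nonpos hz]; positivity
          · exact (smoothPos_le hz).trans (by nlinarith)
        have h3 : a * smoothPos (‖z‖ ^ 2 - R ^ 2) ≤ a * ‖z‖ ^ 2 := by gcongr
        simp only [hH', hC]
        linarith
      nonneg_b := by positivity
      sq_le := fun z => by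
        have h1 := sub_one_le_smoothPos (‖z‖ ^ 2 - R ^ 2)
        have h2 := hH0 z
        simp only [hH']
        nlinarith
      norm_grad_sub_le := fun z => by
        have h1 : h' z - (3 * Real.pi) • z = h z - (2 * a) • ((1 - σ z) • z) := by
          rw [hcut, ha]; module
        have h2 : ‖h z‖ ≤ ‖h 0‖ + L * R := by
          rcases le_total ‖z‖ R with hz | hz
          · have h3 := hL.norm_sub_le z 0
            have h4 := norm_le_norm_add_norm_sub (h 0) (h z)
            rw [norm_sub_rev, sub_zero] at h3
            have h5 : L * ‖z‖ ≤ L * R := by gcongr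
            linarith
          · rw [hh0 z hz, norm_zero]; positivity
        have h3 := norm_cutoff_le hR z
        have h4 : ‖(2 * a) • ((1 - σ z) • z)‖ ≤ 2 * a * (R + 1) := by
          rw [norm_smul, Real.norm_of_nonneg (by positivity)]
          gcongr
        rw [h1]
        exact (norm_sub_le _ _).trans (by linarith) }
  obtain ⟨x, hxp, hxd, hxa⟩ := hAQ.hasActionOrbit hJ (K₀ := K₀)
    ((Nat.le_ceil _).trans (by simp [hK₀])) (by simp [hK₀])
  have hcons : ∀ t, a * smoothPos (‖x t‖ ^ 2 - R ^ 2) = a * smoothPos (‖x 0‖ ^ 2 - R ^ 2) := by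
    have hder : ∀ t, HasDerivAt (fun t => a * smoothPos (‖x t‖ ^ 2 - R ^ 2)) 0 t := by
      intro t
      refine ((isGradientOf_smoothPos a R).comp (hxd t)).congr_deriv ?_
      rcases le_or_gt ‖x t‖ R with hz | hz
      · rw [Real.smoothTransition.zero_of_nonpos (hin _ hz)]; simp
      · simp [hh', hh0 _ hz.le, inner_smul_left, inner_smul_right, hJ.inner_self]
    intro t
    exact is_const_of_deriv_eq_zero (fun t => (hder t).differentiableAt)
      (fun t => (hder t).deriv) t 0
  by_cases h0 : ‖x 0‖ ≤ R
  · have hle : ∀ t, ‖x t‖ ≤ R := by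
      intro t
      have h1 := hcons t
      rw [smoothPos_of_nonpos (hin _ h0), mul_zero] at h1
      by_contra! hlt
      have := smoothPos_pos (s := ‖x t‖ ^ 2 - R ^ 2) (by nlinarith)
      nlinarith
    have hhx : ∀ t, h' (x t) = h (x t) := fun t => by
      simp only [hh', hσ, Real.smoothTransition.zero_of_nonpos (hin _ (hle t))]
      simp
    have hHx : ∀ t, H' (x t) = H (x t) := fun t => by
      simp only [hH', smoothPos_of_nonpos (hin _ (hle t))]
      simp
    simp only [hhx, hHx] at hxd hxa
    exact ⟨x, hxp, hxd, hxa⟩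
  · exfalso
    push Not at h0
    have hgt : ∀ t, R < ‖x t‖ := by
      intro t
      have h1 := hcons t
      by_contra! hlt
      rw [smoothPos_of_nonpos (hin _ hlt)] at h1
      have := smoothPos_pos (s := ‖x 0‖ ^ 2 - R ^ 2) (by nlinarith)
      nlinarith
    have hneg : ∫ t in (0 : ℝ)..1, (1 / 2 * inner ℝ (h' (x t)) (x t) - H' (x t)) ≤ 0 := by
      have : ∀ t, (1 / 2 * inner ℝ (h' (x t)) (x t) - H' (x t)) ≤ 0 := by
        intro t
        have h1 := sub_one_le_smoothPos (‖x t‖ ^ 2 - R ^ 2)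
        have h2 := Real.smoothTransition.le_one (‖x t‖ ^ 2 - R ^ 2)
        simp only [hh', hH', hh0 _ (hgt t).le, hHR _ (hgt t).le, zero_add, inner_smul_left,
          real_inner_self_eq_norm_sq, conj_trivial]
        have h3 : σ (x t) * ‖x t‖ ^ 2 ≤ 1 * ‖x t‖ ^ 2 := by gcongr
        nlinarith
      rw [← neg_nonneg, ← intervalIntegral.integral_neg]
      exact integral_nonneg zero_le_one fun t _ => neg_nonneg.2 (this t)
    have hβ : 0 < Real.pi / 4 * (r / (2 * K₀)) ^ 2 := by positivity
    linarith

end cutoff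

section smoothTransition

theorem contDiff_deriv_smoothTransition : ContDiff ℝ 1 (deriv Real.smoothTransition) :=
  (contDiff_succ_iff_deriv (n := 1).1 (Real.smoothTransition.contDiff)).2.2

theorem hasDerivAt_smoothTransition (s : ℝ) :
    HasDerivAt Real.smoothTransition (deriv Real.smoothTransition s) s :=
  ((Real.smoothTransition.contDiff (n := 1)).differentiable one_ne_zero s).hasDerivAt

theorem deriv_smoothTransition_of_nonpos {s : ℝ} (hs : s ≤ 0) :
    deriv Real.smoothTransition s = 0 :=
  IsLocalMin.deriv_eq_zero (.of_forall fun u => by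
    rw [Real.smoothTransition.zero_of_nonpos hs]; exact Real.smoothTransition.nonneg u)

theorem deriv_smoothTransition_of_one_le {s : ℝ} (hs : 1 ≤ s) :
    deriv Real.smoothTransition s = 0 :=
  IsLocalMax.deriv_eq_zero (.of_forall fun u => by
    rw [Real.smoothTransition.one_of_one_le hs]; exact Real.smoothTransition.le_one u)

theorem exists_abs_deriv_smoothTransition_le :
    ∃ M : ℝ, ∀ s, |deriv Real.smoothTransition s| ≤ M := by
  obtain ⟨M, hM⟩ := (isCompact_Icc (a := (0 : ℝ)) (b := 1)).exists_bound_of_continuousOn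
    contDiff_deriv_smoothTransition.continuous.continuousOn
  refine ⟨M, fun s => ?_⟩
  by_cases hs : s ∈ Icc (0 : ℝ) 1
  · exact hM s hs
  · have h0 : (0 : ℝ) ≤ M := (norm_nonneg _).trans (hM 0 (by simp))
    have : deriv Real.smoothTransition s = 0 := by
      rw [mem_Icc, not_and_or, not_le, not_le] at hs
      rcases hs with hs | hs
      · exact deriv_smoothTransition_of_nonpos hs.le
      · exact deriv_smoothTransition_of_one_le hs.le
    rwa [this, abs_zero]

end smoothTransition

section shell
variable {E : Type*} [NormedAddCommGroup E] [InnerProductSpace ℝ E] {J : E →L[ℝ] E}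
  {f : E → ℝ} {F : E → E}

/-- Hamiltonians with gradient `h` that vanish on the ball of radius `r`, are equal to their
maximum `m` on `{c ≤ f}`, and take values in `[0, m]`. -/
structure IsAdmissible (f : E → ℝ) (r c m : ℝ) (H : E → ℝ) (h : E → E) : Prop where
  grad : IsGradientOf H h
  lipschitz : ∃ L, LipschitzWith L h
  nonneg : ∀ z, 0 ≤ H z
  le : ∀ z, H z ≤ m
  eq_zero : ∀ z, ‖z‖ ≤ r → H z = 0
  eq_max : ∀ z, c ≤ f z → H z = m

theorem IsAdmissible.grad_eq_zero {r c m : ℝ} {H : E → ℝ} {h : E → E}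
    (hH : IsAdmissible f r c m H h) {z : E} (hz : c ≤ f z) : h z = 0 :=
  hH.grad.eq_zero_of_max fun w => (hH.le w).trans_eq (hH.eq_max z hz).symm

/-- Adding to an admissible Hamiltonian a steep function of `f` supported in a thin shell. -/
theorem IsAdmissible.add_shell [FiniteDimensional ℝ E] (hf : IsGradientOf f F)
    (hF : ContDiff ℝ 1 F) (hbd : ∀ c, ∃ R, ∀ z, f z ≤ c → ‖z‖ ≤ R) {r c m : ℝ} {H : E → ℝ}
    {h : E → E} (hH : IsAdmissible f r c m H h) (hr : ∀ z, ‖z‖ ≤ r → f z ≤ c) {K τ : ℝ}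
    (hK : 0 ≤ K) (hτ : 0 < τ) :
    IsAdmissible f r (c + τ) (m + K * τ)
      (fun z => H z + K * τ * Real.smoothTransition ((f z - c) / τ))
      (fun z => h z + (K * deriv Real.smoothTransition ((f z - c) / τ)) • F z) where
  grad z := by
    have h1 := ((hasDerivAt_smoothTransition ((f z - c) / τ)).comp_hasFDerivAt z
      (((hf z).sub_const c).mul_const τ⁻¹)).const_mul (K * τ)
    refine ((hH.grad z).add h1).congr_fderiv ?_
    ext w
    simp
    field_simp
  lipschitz := by
    obtain ⟨L, hL⟩ := hH.lipschitz
    have hfc : ContDiff ℝ 1 f := by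
      rw [contDiff_one_iff_hasFDerivAt]
      exact ⟨fun z => innerSL ℝ (F z), (innerSL ℝ).continuous.comp hF.continuous, hf⟩
    obtain ⟨L', hL'⟩ : ∃ L', LipschitzWith L'
        fun z => (K * deriv Real.smoothTransition ((f z - c) / τ)) • F z := by
      refine ContDiff.lipschitzWith_of_hasCompactSupport (𝕂 := ℝ) (n := 1) ?_ ?_ one_ne_zero
      · have : ProperSpace E := FiniteDimensional.proper ℝ E
        obtain ⟨R, hR⟩ := hbd (c + τ)
        refine HasCompactSupport.intro (isCompact_closedBall (0 : E) R) fun z hz => ?_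
        rw [mem_closedBall_zero_iff] at hz
        have : c + τ < f z := not_le.1 fun h => hz (hR z h)
        rw [deriv_smoothTransition_of_one_le (by rw [le_div_iff₀ hτ]; linarith), mul_zero,
          zero_smul]
      · exact (contDiff_const.mul (contDiff_deriv_smoothTransition.comp
          ((hfc.sub contDiff_const).div_const τ))).smul hF
    exact ⟨_, hL.add hL'⟩
  nonneg z := add_nonneg (hH.nonneg z)
    (mul_nonneg (mul_nonneg hK hτ.le) (Real.smoothTransition.nonneg _))
  le z := add_le_add (hH.le z)
    (mul_le_of_le_one_right (mul_nonneg hK hτ.le) (Real.smoothTransition.le_one _))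
  eq_zero z hz := by
    rw [hH.eq_zero z hz, Real.smoothTransition.zero_of_nonpos
      (div_nonpos_of_nonpos_of_nonneg (by linarith [hr z hz]) hτ.le)]
    simp
  eq_max z hz := by
    rw [hH.eq_max z (by linarith), Real.smoothTransition.one_of_one_le
      (by rw [le_div_iff₀ hτ]; linarith), mul_one]

/-- If an orbit appears when a steep function of `f` is added in a thin shell, it lies on a level
of `f` in the shell. -/
theorem IsAdmissible.exists_orbit_in_shell (hJ : IsOrthogonalComplexStructure J)
    (hf : IsGradientOf f F) {r c m : ℝ} {H : E → ℝ} {h : E → E}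
    (hH : IsAdmissible f r c m H h) {K τ β : ℝ} (hK : 0 ≤ K) (hτ : 0 < τ) (hβ : 0 < β)
    (hno : ¬HasActionOrbit J H h β)
    (horb : HasActionOrbit J (fun z => H z + K * τ * Real.smoothTransition ((f z - c) / τ))
      (fun z => h z + (K * deriv Real.smoothTransition ((f z - c) / τ)) • F z) β)
    {M : ℝ} (hM : ∀ s, |deriv Real.smoothTransition s| ≤ M) :
    ∃ (x : ℝ → E) (κ c' : ℝ), |κ| ≤ K * M ∧ (∀ t, x (t + 1) = x t) ∧
      (∀ t, HasDerivAt x (κ • J (F (x t))) t) ∧ c ≤ c' ∧ c' ≤ c + τ ∧ (∀ t, f (x t) = c') ∧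
      β ≤ ∫ t in (0 : ℝ)..1, 1 / 2 * (κ * inner ℝ (F (x t)) (x t)) := by
  obtain ⟨x, hxp, hxd, hxa⟩ := horb
  have hfx : ∀ t, HasDerivAt (fun t => f (x t)) (inner ℝ (F (x t)) (J (h (x t)))) t := fun t => by
    refine (hf.comp (hxd t)).congr_deriv ?_
    simp [inner_add_right, inner_smul_right, hJ.inner_self]
  have hcons : ∀ t, smoothPos (f (x t) - c) = smoothPos (f (x 0) - c) := by
    have hder : ∀ t, HasDerivAt (fun t => smoothPos (f (x t) - c)) 0 t := by
      intro t
      refine ((hasDerivAt_smoothPos _).comp t ((hfx t).sub_const c)).congr_deriv ?_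
      rcases le_total (f (x t)) c with hz | hz
      · rw [Real.smoothTransition.zero_of_nonpos (by linarith), zero_mul]
      · rw [hH.grad_eq_zero hz, map_zero, inner_zero_right, mul_zero]
    intro t
    exact is_const_of_deriv_eq_zero (fun t => (hder t).differentiableAt)
      (fun t => (hder t).deriv) t 0
  by_cases h0 : f (x 0) ≤ c
  · have hle : ∀ t, (f (x t) - c) / τ ≤ 0 := by
      intro t
      refine div_nonpos_of_nonpos_of_nonneg ?_ hτ.le
      by_contra! hlt
      have h1 := hcons t
      rw [smoothPos_of_nonpos (by linarith : f (x 0) - c ≤ 0)] at h1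
      exact (smoothPos_pos hlt).ne' h1
    simp only [deriv_smoothTransition_of_nonpos (hle _),
      Real.smoothTransition.zero_of_nonpos (hle _), mul_zero, zero_smul, add_zero] at hxd hxa
    exact absurd ⟨x, hxp, hxd, hxa⟩ hno
  · push Not at h0
    have hgt : ∀ t, c < f (x t) := by
      intro t
      by_contra! hlt
      have h1 := hcons t
      rw [smoothPos_of_nonpos (by linarith : f (x t) - c ≤ 0)] at h1
      exact (smoothPos_pos (by linarith : 0 < f (x 0) - c)).ne h1
    have hconst : ∀ t, f (x t) = f (x 0) := by
      intro t
      have h1 : ∀ t, HasDerivAt (fun t => f (x t)) 0 t := fun t => by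
        refine (hfx t).congr_deriv ?_
        rw [hH.grad_eq_zero (hgt t).le, map_zero, inner_zero_right]
      exact is_const_of_deriv_eq_zero (fun t => (h1 t).differentiableAt)
        (fun t => (h1 t).deriv) t 0
    set κ := K * deriv Real.smoothTransition ((f (x 0) - c) / τ) with hκ
    simp only [hH.grad_eq_zero (hgt _).le, hconst, ← hκ, zero_add, map_smul, inner_smul_left,
      hH.eq_max _ (hgt _).le, conj_trivial] at hxd hxa
    have hxc : Continuous x := continuous_iff_continuousAt.2 fun t => (hxd t).continuousAt
    have hm : 0 ≤ m := (hH.nonneg 0).trans (hH.le 0)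
    have hact : β ≤ ∫ t in (0 : ℝ)..1, 1 / 2 * (κ * inner ℝ (F (x t)) (x t)) := by
      set q := m + K * τ * Real.smoothTransition ((f (x 0) - c) / τ) with hq
      have hq0 : 0 ≤ q := add_nonneg hm
        (mul_nonneg (mul_nonneg hK hτ.le) (Real.smoothTransition.nonneg _))
      by_cases hInt : IntervalIntegrable
        (fun t => 1 / 2 * (κ * inner ℝ (F (x t)) (x t))) volume 0 1
      · rw [integral_sub hInt (by simp)] at hxa
        simp at hxa
        simp
        linarith
      · have : ¬IntervalIntegrable
            (fun t => 1 / 2 * (κ * inner ℝ (F (x t)) (x t)) - q) volume 0 1 := fun h1 =>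
          hInt (by simpa using h1.add (intervalIntegrable_const (c := q)))
        rw [integral_undef this] at hxa
        linarith
    refine ⟨x, κ, f (x 0), ?_, hxp, hxd, h0.le, ?_, hconst, hact⟩
    · rw [hκ, abs_mul, abs_of_nonneg hK]
      exact mul_le_mul_of_nonneg_left (hM _) hK
    · by_contra! hlt
      rw [hκ, deriv_smoothTransition_of_one_le (by rw [le_div_iff₀ hτ]; linarith)] at hact
      simp at hact
      linarith

end shell

section capacity
variable {E : Type*} [NormedAddCommGroup E] [InnerProductSpace ℝ E] {J : E →L[ℝ] E}
  {f : E → ℝ} {F : E → E}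

theorem IsAdmissible.mono {r c c' m : ℝ} {H : E → ℝ} {h : E → E} (hH : IsAdmissible f r c m H h)
    (hc : c ≤ c') : IsAdmissible f r c' m H h :=
  { hH with eq_max := fun z hz => hH.eq_max z (hc.trans hz) }

theorem isAdmissible_zero (f : E → ℝ) (r c : ℝ) : IsAdmissible f r c 0 (fun _ => 0) fun _ => 0 where
  grad z := by simpa using hasFDerivAt_const (0 : ℝ) z
  lipschitz := ⟨0, LipschitzWith.const 0⟩
  nonneg _ := le_rfl
  le _ := le_rfl
  eq_zero _ _ := rfl
  eq_max _ _ := rfl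

theorem not_hasActionOrbit_zero {β : ℝ} (hβ : 0 < β) :
    ¬HasActionOrbit J (fun _ => 0) (fun _ => 0) β := by
  rintro ⟨x, -, -, hx⟩
  simp at hx
  linarith

/-- The oscillations, at most `C`, of the admissible Hamiltonians that have no periodic orbit of
action at least `β`. -/
def nonAdmittingOscillations (J : E →L[ℝ] E) (f : E → ℝ) (r C β c : ℝ) : Set ℝ :=
  {m | m ≤ C ∧ ∃ H h, IsAdmissible f r c m H h ∧ ¬HasActionOrbit J H h β}

theorem bddAbove_nonAdmittingOscillations (r C β c : ℝ) :
    BddAbove (nonAdmittingOscillations J f r C β c) := ⟨C, fun _ hm => hm.1⟩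

theorem zero_mem_nonAdmittingOscillations {C β : ℝ} (hC : 0 ≤ C) (hβ : 0 < β) (r c : ℝ) :
    0 ∈ nonAdmittingOscillations J f r C β c :=
  ⟨hC, _, _, isAdmissible_zero f r c, not_hasActionOrbit_zero hβ⟩

theorem monotone_sSup_nonAdmittingOscillations {C β : ℝ} (hC : 0 ≤ C) (hβ : 0 < β) (r : ℝ) :
    Monotone fun c => sSup (nonAdmittingOscillations J f r C β c) := fun c c' hcc =>
  csSup_le_csSup (bddAbove_nonAdmittingOscillations r C β c')
    ⟨0, zero_mem_nonAdmittingOscillations hC hβ r c⟩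
    fun _ ⟨hm, H, h, hH, hno⟩ => ⟨hm, H, h, hH.mono hcc, hno⟩

theorem ae_exists_orbit_near [FiniteDimensional ℝ E] [Nontrivial E]
    (hJ : IsOrthogonalComplexStructure J) (hf : IsGradientOf f F) (hF : ContDiff ℝ 1 F)
    (hbd : ∀ c, ∃ R, ∀ z, f z ≤ c → ‖z‖ ≤ R) {c₀ c₁ : ℝ} (h0 : f 0 < c₀) :
    ∃ β > 0, ∀ᵐ c : ℝ, c ∈ Ioo c₀ c₁ → ∃ B, ∀ᶠ τ in 𝓝[>] (0 : ℝ),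
      ∃ (x : ℝ → E) (κ c' : ℝ), |κ| ≤ B ∧ (∀ t, x (t + 1) = x t) ∧
      (∀ t, HasDerivAt x (κ • J (F (x t))) t) ∧ c ≤ c' ∧ c' ≤ c + τ ∧ (∀ t, f (x t) = c') ∧
      β ≤ ∫ t in (0 : ℝ)..1, 1 / 2 * (κ * inner ℝ (F (x t)) (x t)) := by
  obtain ⟨r, hr, hrc⟩ : ∃ r > 0, ∀ z : E, ‖z‖ ≤ r → f z < c₀ := by
    have h1 := (hf 0).continuousAt.eventually_lt_const h0
    obtain ⟨r, hr, h2⟩ := Metric.nhds_basis_closedBall.mem_iff.1 h1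
    exact ⟨r, hr, fun z hz => h2 (by simpa using hz)⟩
  obtain ⟨R, hrR, hR⟩ : ∃ R, r ≤ R ∧ ∀ z, R ≤ ‖z‖ → c₁ < f z := by
    obtain ⟨R, hR⟩ := hbd c₁
    refine ⟨max r (R + 1), le_max_left _ _, fun z hz => ?_⟩
    by_contra! hlt
    linarith [hR z hlt, le_max_right r (R + 1)]
  obtain ⟨β, hβ, hcore⟩ := exists_hasActionOrbit_of_oscillation hJ hr hrR
  obtain ⟨M, hM⟩ := exists_abs_deriv_smoothTransition_le
  set C := 3 * Real.pi / 2 * (R ^ 2 + 1)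
  have hC : 0 ≤ C := by positivity
  have hmono := monotone_sSup_nonAdmittingOscillations (J := J) (f := f) hC hβ r
  refine ⟨β, hβ, ?_⟩
  filter_upwards [hmono.ae_differentiableAt] with c hdiff hc
  set N := fun c => sSup (nonAdmittingOscillations J f r C β c) with hN
  set K := |deriv N c| + 2 with hKdef
  have hK : 0 < K := by positivity
  have hslope : ∀ᶠ τ in 𝓝[>] (0 : ℝ), |N (c + τ) - N c - τ * deriv N c| ≤ |τ| := by
    have := (hasDerivAt_iff_isLittleO_nhds_zero.1 hdiff.hasDerivAt).def one_pos
    simpa using this.filter_mono nhdsWithin_le_nhds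
  refine ⟨K * M, ?_⟩
  filter_upwards [hslope, Ioc_mem_nhdsGT (show (0 : ℝ) < min (c₁ - c) K⁻¹ from
    lt_min (sub_pos.2 hc.2) (inv_pos.2 hK))] with τ hτN ⟨hτ, hτ'⟩
  have hτc : c + τ ≤ c₁ := by linarith [hτ'.trans (min_le_left _ _)]
  have hτK : K * τ ≤ 1 := by
    calc K * τ ≤ K * K⁻¹ := mul_le_mul_of_nonneg_left (hτ'.trans (min_le_right _ _)) hK.le
      _ = 1 := mul_inv_cancel₀ hK.ne'
  obtain ⟨m, ⟨hmC, H, h, hH, hno⟩, hm⟩ := exists_lt_of_lt_csSup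
    ⟨0, zero_mem_nonAdmittingOscillations (J := J) (f := f) hC hβ r c⟩
    (show N c - τ < N c by linarith)
  have hH1 := hH.add_shell hf hF hbd (fun z hz => ((hrc z hz).trans hc.1).le) hK.le hτ
  refine hH.exists_orbit_in_shell hJ hf hK.le hτ hβ hno ?_ hM
  by_contra hno1
  rcases le_or_gt (m + K * τ) C with hmC1 | hmC1
  · have h2 : m + K * τ ≤ N (c + τ) := le_csSup (bddAbove_nonAdmittingOscillations r C β (c + τ))
      ⟨hmC1, _, _, hH1, hno1⟩
    rw [abs_of_pos hτ] at hτN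
    have h3 := (abs_le.1 hτN).2
    have h4 : τ * deriv N c ≤ τ * |deriv N c| := mul_le_mul_of_nonneg_left (le_abs_self _) hτ.le
    have h5 : K * τ = τ * |deriv N c| + 2 * τ := by rw [hKdef]; ring
    linarith
  · exact hno1 (hcore _ _ _ hH1.grad hH1.lipschitz hH1.nonneg hH1.le hH1.eq_zero
      (fun z hz => hH1.eq_max z (hτc.trans (hR z hz).le)) hmC1.le (by linarith))

end capacity

section limit
open Filter
variable {E : Type*} [NormedAddCommGroup E] [InnerProductSpace ℝ E] {J : E →L[ℝ] E}
  {f : E → ℝ} {F : E → E}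

theorem exists_orbit_of_eventually_near [FiniteDimensional ℝ E] (hfc : Continuous f)
    (hF : Continuous F) (hbd : ∀ c, ∃ R, ∀ z, f z ≤ c → ‖z‖ ≤ R) {β B c : ℝ}
    (hnear : ∀ᶠ τ in 𝓝[>] (0 : ℝ),
      ∃ (x : ℝ → E) (κ c' : ℝ), |κ| ≤ B ∧ (∀ t, x (t + 1) = x t) ∧
      (∀ t, HasDerivAt x (κ • J (F (x t))) t) ∧ c ≤ c' ∧ c' ≤ c + τ ∧ (∀ t, f (x t) = c') ∧
      β ≤ ∫ t in (0 : ℝ)..1, 1 / 2 * (κ * inner ℝ (F (x t)) (x t))) :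
    ∃ (x : ℝ → E) (κ : ℝ), (∀ t, x (t + 1) = x t) ∧
      (∀ t, HasDerivAt x (κ • J (F (x t))) t) ∧ (∀ t, f (x t) = c) ∧
      β ≤ ∫ t in (0 : ℝ)..1, 1 / 2 * (κ * inner ℝ (F (x t)) (x t)) := by
  have : ProperSpace E := FiniteDimensional.proper ℝ E
  have hex : ∀ n : ℕ, ∃ (x : ℝ → E) (κ c' : ℝ), |κ| ≤ B ∧ (∀ t, x (t + 1) = x t) ∧
      (∀ t, HasDerivAt x (κ • J (F (x t))) t) ∧ c ≤ c' ∧ c' ≤ c + 1 / ((n : ℝ) + 1) ∧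
      (∀ t, f (x t) = c') ∧
      β ≤ ∫ t in (0 : ℝ)..1, 1 / 2 * (κ * inner ℝ (F (x t)) (x t)) := by
    intro n
    obtain ⟨τ, ⟨x, κ, c', h1, h2, h3, h4, h5, h6⟩, hτ⟩ :=
      (hnear.and (Ioc_mem_nhdsGT (Nat.one_div_pos_of_nat (n := n)))).exists
    exact ⟨x, κ, c', h1, h2, h3, h4, h5.trans (by linarith [hτ.2]), h6⟩
  choose x κ c' hκ hxp hxd hc hc' hfx hact using hex
  obtain ⟨R, hR⟩ := hbd (c + 1)
  have hxR : ∀ n t, ‖x n t‖ ≤ R := fun n t => hR _ <| by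
    rw [hfx]
    have : 1 / ((n : ℝ) + 1) ≤ 1 := by
      rw [div_le_one (by positivity)]; linarith [n.cast_nonneg (α := ℝ)]
    linarith [hc' n]
  obtain ⟨A, hA⟩ := (isCompact_closedBall (0 : E) R).exists_bound_of_continuousOn hF.continuousOn
  have hFx : ∀ n t, ‖F (x n t)‖ ≤ A := fun n t => hA _ (mem_closedBall_zero_iff.2 (hxR n t))
  have hB : 0 ≤ B := (abs_nonneg _).trans (hκ 0)
  have hA0 : 0 ≤ A := (norm_nonneg _).trans (hFx 0 0)
  have hR0 : 0 ≤ R := (norm_nonneg _).trans (hxR 0 0)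
  have hder : ∀ n t, ‖κ n • J (F (x n t))‖ ≤ B * (‖J‖ * A) := fun n t => by
    rw [norm_smul]
    exact mul_le_mul (hκ n) (J.le_opNorm_of_le (hFx n t)) (norm_nonneg _) hB
  have hlip : ∀ n, LipschitzWith (B * (‖J‖ * A)).toNNReal (x n) := fun n => by
    refine lipschitzWith_of_nnnorm_deriv_le (𝕜 := ℝ) (fun t => (hxd n t).differentiableAt)
      fun t => ?_
    rw [(hxd n t).deriv, ← NNReal.coe_le_coe, coe_nnnorm, Real.coe_toNNReal _ (by positivity)]
    exact hder n t
  have hxc : ∀ n, Continuous (x n) := fun n => (hlip n).continuous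
  obtain ⟨κ₀, -, ψ, hψ, hκψ⟩ := (isCompact_Icc (a := -B) (b := B)).tendsto_subseq
    (x := κ) fun n => abs_le.1 (hκ n)
  obtain ⟨y, φ, hφ, hyc, hyp, hy⟩ := exists_tendsto_subseq_of_equicontinuous_periodic
    (x := fun n => x (ψ n)) (fun n => hxp (ψ n)) (fun n => hxR (ψ n))
    (LipschitzWith.uniformEquicontinuous _ _ fun n => hlip (ψ n)).equicontinuous
  have hκφ : Tendsto (fun n => κ (ψ (φ n))) atTop (𝓝 κ₀) := hκψ.comp hφ.tendsto_atTop
  have hFy : ∀ t, Tendsto (fun n => F (x (ψ (φ n)) t)) atTop (𝓝 (F (y t))) := fun t =>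
    (hF.tendsto _).comp (hy t)
  have hcont : Continuous fun s => κ₀ • J (F (y s)) := by fun_prop
  have hInt : ∀ t, y t = y 0 + ∫ s in (0 : ℝ)..t, κ₀ • J (F (y s)) := by
    intro t
    have h1 := tendsto_integral_of_bounded (u := fun n s => κ (ψ (φ n)) • J (F (x (ψ (φ n)) s)))
      (v := fun s => κ₀ • J (F (y s))) (fun n => by have := hxc (ψ (φ n)); fun_prop)
      (fun n s => hder _ s) (fun s => hκφ.smul ((J.continuous.tendsto _).comp (hFy s))) 0 t
    refine tendsto_nhds_unique (hy t) (((hy 0).add h1).congr fun n => ?_)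
    rw [integral_eq_sub_of_hasDerivAt (fun s _ => hxd _ s)
      ((by have := hxc (ψ (φ n)); fun_prop :
        Continuous fun s => κ (ψ (φ n)) • J (F (x (ψ (φ n)) s))).intervalIntegrable _ _)]
    simp
  refine ⟨y, κ₀, hyp, fun t => ?_, fun t => ?_, ?_⟩
  · have h1 : HasDerivAt (fun t => y 0 + ∫ s in (0 : ℝ)..t, κ₀ • J (F (y s)))
        (κ₀ • J (F (y t))) t :=
      (integral_hasDerivAt_right (hcont.intervalIntegrable _ _)
        (hcont.stronglyMeasurableAtFilter _ _) hcont.continuousAt).const_add _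
    rwa [← funext hInt] at h1
  · have h1 : Tendsto (fun n => c' (ψ (φ n))) atTop (𝓝 c) := by
      have h2 : Tendsto c' atTop (𝓝 c) := by
        refine tendsto_of_tendsto_of_tendsto_of_le_of_le tendsto_const_nhds ?_ hc hc'
        simpa using tendsto_one_div_add_atTop_nhds_zero_nat.const_add c
      exact h2.comp (hψ.comp hφ).tendsto_atTop
    refine tendsto_nhds_unique (((hfc.tendsto _).comp (hy t)).congr fun n => ?_) h1
    exact hfx _ t
  · refine ge_of_tendsto' (tendsto_integral_of_bounded
      (u := fun n t => 1 / 2 * (κ (ψ (φ n)) * inner ℝ (F (x (ψ (φ n)) t)) (x (ψ (φ n)) t)))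
      (v := fun t => 1 / 2 * (κ₀ * inner ℝ (F (y t)) (y t)))
      (M := 1 / 2 * (B * (A * R)))
      (fun n => by have := hxc (ψ (φ n)); fun_prop) (fun n t => ?_)
      (fun t => (hκφ.mul ((hFy t).inner (hy t))).const_mul _) 0 1) fun n => hact _
    rw [norm_mul, norm_mul, Real.norm_of_nonneg (by norm_num : (0 : ℝ) ≤ 1 / 2)]
    gcongr
    · exact hκ _
    · exact (norm_inner_le_norm _ _).trans
        (mul_le_mul (hFx _ t) (hxR _ t) (norm_nonneg _) hA0)

/-- The level `c` of `f` carries a nonconstant periodic orbit of `J F`. -/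
def HasPeriodicOrbit (J : E →L[ℝ] E) (f : E → ℝ) (F : E → E) (c : ℝ) : Prop :=
  ∃ γ : ℝ → E, (∀ t, HasDerivAt γ (J (F (γ t))) t) ∧ (∀ t, f (γ t) = c) ∧
    (∃ T > 0, ∀ t, γ (t + T) = γ t) ∧ ∃ t s, γ t ≠ γ s

theorem hasPeriodicOrbit_of_rescaled (hJ : IsOrthogonalComplexStructure J) {x : ℝ → E}
    {κ c β : ℝ} (hβ : 0 < β) (hxp : ∀ t, x (t + 1) = x t)
    (hxd : ∀ t, HasDerivAt x (κ • J (F (x t))) t) (hfx : ∀ t, f (x t) = c)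
    (hact : β ≤ ∫ t in (0 : ℝ)..1, 1 / 2 * (κ * inner ℝ (F (x t)) (x t))) :
    HasPeriodicOrbit J f F c := by
  have hκ : κ ≠ 0 := by
    rintro rfl
    simp at hact
    linarith
  have hscale : ∀ t, HasDerivAt (fun t => x (κ⁻¹ * t)) (J (F (x (κ⁻¹ * t)))) t := fun t => by
    refine ((hxd (κ⁻¹ * t)).scomp t ((hasDerivAt_id t).const_mul κ⁻¹)).congr_deriv ?_
    simp [smul_smul, hκ]
  have hper : ∀ t, x (t - 1) = x t := fun t => by rw [← hxp (t - 1), sub_add_cancel]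
  refine ⟨fun t => x (κ⁻¹ * t), hscale, fun t => hfx _, ⟨|κ|, abs_pos.2 hκ, fun t => ?_⟩, ?_⟩
  · rcases abs_choice κ with h | h
    · simp only [h, mul_add, inv_mul_cancel₀ hκ, hxp]
    · simp only [h, ← sub_eq_add_neg, mul_sub, inv_mul_cancel₀ hκ, hper]
  · by_contra! hconst
    have hx0 : ∀ t, F (x t) = 0 := fun t => by
      have h1 := (hscale (κ * t)).unique ((hasDerivAt_const (κ * t)
        (x (κ⁻¹ * 0))).congr_of_eventuallyEq (.of_forall fun s => hconst s 0))
      rw [inv_mul_cancel_left₀ hκ] at h1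
      rw [← norm_eq_zero, ← hJ.norm_map, h1, norm_zero]
    simp [hx0] at hact
    linarith

theorem ae_hasPeriodicOrbit_of_mem_Ioo [FiniteDimensional ℝ E] [Nontrivial E]
    (hJ : IsOrthogonalComplexStructure J) (hf : IsGradientOf f F) (hF : ContDiff ℝ 1 F)
    (hbd : ∀ c, ∃ R, ∀ z, f z ≤ c → ‖z‖ ≤ R) {c₀ : ℝ} (c₁ : ℝ) (h0 : f 0 < c₀) :
    ∀ᵐ c : ℝ, c ∈ Ioo c₀ c₁ → HasPeriodicOrbit J f F c := by
  obtain ⟨β, hβ, h⟩ := ae_exists_orbit_near hJ hf hF hbd (c₁ := c₁) h0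
  filter_upwards [h] with c hc hcmem
  obtain ⟨B, hB⟩ := hc hcmem
  obtain ⟨x, κ, h1, h2, h3, h4⟩ := exists_orbit_of_eventually_near
    (continuous_iff_continuousAt.2 fun z => (hf z).continuousAt) hF.continuous hbd hB
  exact hasPeriodicOrbit_of_rescaled hJ hβ h1 h2 h3 h4

theorem ae_hasPeriodicOrbit_of_lt [FiniteDimensional ℝ E] [Nontrivial E]
    (hJ : IsOrthogonalComplexStructure J) (hf : IsGradientOf f F) (hF : ContDiff ℝ 1 F)
    (hbd : ∀ c, ∃ R, ∀ z, f z ≤ c → ‖z‖ ≤ R) :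
    ∀ᵐ c : ℝ, f 0 < c → HasPeriodicOrbit J f F c := by
  have h : ∀ n : ℕ, ∀ᵐ c : ℝ, c ∈ Ioo (f 0 + 1 / ((n : ℝ) + 1)) n → HasPeriodicOrbit J f F c :=
    fun n => ae_hasPeriodicOrbit_of_mem_Ioo hJ hf hF hbd n
      (lt_add_of_pos_right _ Nat.one_div_pos_of_nat)
  filter_upwards [ae_all_iff.2 h] with c hc h0
  have h1 : ∀ᶠ n : ℕ in atTop, f 0 + 1 / ((n : ℝ) + 1) < c := by
    have : Tendsto (fun n : ℕ => f 0 + 1 / ((n : ℝ) + 1)) atTop (𝓝 (f 0 + 0)) :=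
      tendsto_one_div_add_atTop_nhds_zero_nat.const_add _
    exact this.eventually_lt_const (by simpa using h0)
  obtain ⟨n, hn1, hn2⟩ := (h1.and (tendsto_natCast_atTop_atTop.eventually_gt_atTop c)).exists
  exact hc n ⟨hn1, hn2⟩

/-- Almost existence for Hamiltonians with bounded sublevel sets. -/
theorem ae_hasPeriodicOrbit [FiniteDimensional ℝ E] [Nontrivial E]
    (hJ : IsOrthogonalComplexStructure J) (hf : IsGradientOf f F) (hF : ContDiff ℝ 1 F)
    (hbd : ∀ c, ∃ R, ∀ z, f z ≤ c → ‖z‖ ≤ R) :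
    ∀ᵐ c : ℝ, c ∈ range f → HasPeriodicOrbit J f F c := by
  have : ProperSpace E := FiniteDimensional.proper ℝ E
  have hfc : Continuous f := continuous_iff_continuousAt.2 fun z => (hf z).continuousAt
  obtain ⟨z₀, hz₀⟩ : ∃ z₀, ∀ z, f z₀ ≤ f z := by
    obtain ⟨R, hR⟩ := hbd (f 0)
    obtain ⟨z₀, -, hz₀⟩ := (isCompact_closedBall (0 : E) R).exists_isMinOn
      ⟨0, mem_closedBall_zero_iff.2 (hR 0 le_rfl)⟩ hfc.continuousOn
    refine ⟨z₀, fun z => ?_⟩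
    by_cases hz : ‖z‖ ≤ R
    · exact hz₀ (mem_closedBall_zero_iff.2 hz)
    · exact (hz₀ (mem_closedBall_zero_iff.2 (hR 0 le_rfl))).trans
        (not_le.1 fun h => hz (hR z h)).le
  have h1 := ae_hasPeriodicOrbit_of_lt (f := fun z => f (z + z₀)) (F := fun z => F (z + z₀)) hJ
    (fun z => ((hf (z + z₀)).comp z ((hasFDerivAt_id z).add_const z₀)).congr_fderiv
      (ContinuousLinearMap.comp_id _)) (hF.comp (contDiff_id.add contDiff_const))
    fun c => by
      obtain ⟨R, hR⟩ := hbd c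
      refine ⟨R + ‖z₀‖, fun z hz => ?_⟩
      have := norm_sub_le (z + z₀) z₀
      rw [add_sub_cancel_right] at this
      linarith [hR _ hz]
  have h2 : ∀ᵐ c : ℝ, c ≠ f z₀ := Measure.ae_ne volume (f z₀)
  filter_upwards [h1, h2] with c hc hne
  rintro ⟨z, rfl⟩
  obtain ⟨γ, hγ, hγc, ⟨T, hT, hγT⟩, t, s, hts⟩ :=
    hc (by simpa using lt_of_le_of_ne (hz₀ z) hne.symm)
  exact ⟨fun t => γ t + z₀, fun t => (hγ t).add_const z₀, hγc,
    ⟨T, hT, fun t => congrArg (· + z₀) (hγT t)⟩, t, s, by simpa using hts⟩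

end limit

section proper
variable {E : Type*} [NormedAddCommGroup E] [InnerProductSpace ℝ E] {J : E →L[ℝ] E}
  {f : E → ℝ} {F : E → E}

theorem isPreconnected_setOf_lt_norm (hE : 1 < Module.rank ℝ E) {R : ℝ} (hR : 0 ≤ R) :
    IsPreconnected {z : E | R < ‖z‖} := by
  have : {z : E | R < ‖z‖} = (fun p : ℝ × E => p.1 • p.2) '' (Ioi R ×ˢ sphere (0 : E) 1) := by
    ext z
    constructor
    · intro hz
      have hz : R < ‖z‖ := hz
      have hz0 : ‖z‖ ≠ 0 := (hR.trans_lt hz).ne'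
      exact ⟨(‖z‖, ‖z‖⁻¹ • z), ⟨hz, by simp [norm_smul, hz0]⟩, by simp [smul_smul, hz0]⟩
    · rintro ⟨⟨t, u⟩, ⟨ht, hu⟩, rfl⟩
      have ht : R < t := ht
      have hu : ‖u‖ = 1 := by simpa using hu
      show R < ‖t • u‖
      rw [norm_smul, hu, mul_one, Real.norm_of_nonneg (hR.trans ht.le)]
      exact ht
  rw [this]
  exact (isPreconnected_Ioi.prod (isPreconnected_sphere hE 0 1)).image _
    (continuous_fst.smul continuous_snd).continuousOn

/-- A continuous proper function on a space of dimension at least two tends to `+∞` or to `-∞`. -/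
theorem bounded_sublevel_or_bounded_superlevel (hE : 1 < Module.rank ℝ E) (hf : Continuous f)
    (hproper : ∀ K : Set ℝ, IsCompact K → IsCompact (f ⁻¹' K)) :
    (∀ c, ∃ R, ∀ z, f z ≤ c → ‖z‖ ≤ R) ∨ ∀ c, ∃ R, ∀ z, -f z ≤ c → ‖z‖ ≤ R := by
  have hbdd : ∀ a b, ∃ R, 0 ≤ R ∧ ∀ z, f z ∈ Icc a b → ‖z‖ ≤ R := fun a b => by
    obtain ⟨R, hR⟩ := (hproper _ (isCompact_Icc (a := a) (b := b))).isBounded.exists_norm_le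
    exact ⟨max R 0, le_max_right _ _, fun z hz => (hR z hz).trans (le_max_left _ _)⟩
  have hdich : ∀ c, ∃ R, (∀ z, R < ‖z‖ → c < f z) ∨ ∀ z, R < ‖z‖ → f z < c := fun c => by
    obtain ⟨R, hR0, hR⟩ := hbdd c c
    refine ⟨R, ?_⟩
    by_contra! ⟨⟨z, hz, hzc⟩, w, hw, hwc⟩
    obtain ⟨v, hv, hvc⟩ := (isPreconnected_setOf_lt_norm hE hR0).intermediate_value hz hw
      hf.continuousOn ⟨hzc, hwc⟩
    exact not_le.2 hv (hR v (by simp [hvc]))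
  have : Nontrivial E := rank_pos_iff_nontrivial.1 (zero_lt_one.trans hE)
  rw [or_iff_not_imp_left]
  intro hno c
  push Not at hno
  obtain ⟨c₀, hc₀⟩ := hno
  obtain ⟨R₀, h0⟩ := hdich c₀
  obtain ⟨R, h⟩ := hdich (-c)
  replace h0 : ∀ z, R₀ < ‖z‖ → f z < c₀ := h0.resolve_left fun h0 => by
    obtain ⟨z, hz, hzR⟩ := hc₀ R₀
    exact (h0 z hzR).not_ge hz
  have h : ∀ z, R < ‖z‖ → f z < -c := h.resolve_left fun h => by
    obtain ⟨R₁, -, h1⟩ := hbdd (-c) c₀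
    obtain ⟨z, hz⟩ := NormedSpace.exists_lt_norm ℝ E (max R (max R₀ R₁))
    simp only [max_lt_iff] at hz
    exact hz.2.2.not_ge (h1 z ⟨(h z hz.1).le, (h0 z hz.2.1).le⟩)
  refine ⟨R, fun z hz => ?_⟩
  by_contra! hlt
  linarith [h z hlt]

theorem HasPeriodicOrbit.of_neg {c : ℝ}
    (h : HasPeriodicOrbit J (fun z => -f z) (fun z => -F z) (-c)) : HasPeriodicOrbit J f F c := by
  obtain ⟨γ, hγ, hγc, ⟨T, hT, hγT⟩, t, s, hts⟩ := h
  refine ⟨fun t => γ (-t), fun t => ?_, fun t => neg_injective (hγc _), ⟨T, hT, fun t => ?_⟩,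
    -t, -s, by simpa using hts⟩
  · refine ((hγ (-t)).scomp t (hasDerivAt_neg t)).congr_deriv ?_
    simp
  · simp only [← hγT (-(t + T))]
    congr 1
    ring

/-- Almost existence for proper Hamiltonians. -/
theorem ae_hasPeriodicOrbit_of_proper [FiniteDimensional ℝ E] (hE : 1 < Module.rank ℝ E)
    (hJ : IsOrthogonalComplexStructure J) (hf : IsGradientOf f F) (hF : ContDiff ℝ 1 F)
    (hproper : ∀ K : Set ℝ, IsCompact K → IsCompact (f ⁻¹' K)) :
    ∀ᵐ c : ℝ, c ∈ range f → HasPeriodicOrbit J f F c := by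
  have : Nontrivial E := rank_pos_iff_nontrivial.1 (zero_lt_one.trans hE)
  rcases bounded_sublevel_or_bounded_superlevel hE
    (continuous_iff_continuousAt.2 fun z => (hf z).continuousAt) hproper with hbd | hbd
  · exact ae_hasPeriodicOrbit hJ hf hF hbd
  · have hneg : IsGradientOf (fun z => -f z) fun z => -F z := fun z =>
      (hf z).fun_neg.congr_fderiv (map_neg _ _).symm
    have h := ae_hasPeriodicOrbit hJ hneg hF.neg hbd
    filter_upwards [(Measure.measurePreserving_neg volume).quasiMeasurePreserving.ae h] with c hc
    rintro ⟨z, rfl⟩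
    exact (hc ⟨z, rfl⟩).of_neg

end proper

section complexSpace

theorem contDiff_gradient {E : Type*} [NormedAddCommGroup E] [InnerProductSpace ℝ E]
    [CompleteSpace E] {f : E → ℝ} (hf : ContDiff ℝ 2 f) : ContDiff ℝ 1 (gradient f) :=
  (InnerProductSpace.toDual ℝ E).symm.contDiff.comp (hf.fderiv_right (by norm_num))

theorem isGradientOf_gradient {E : Type*} [NormedAddCommGroup E] [InnerProductSpace ℝ E]
    [CompleteSpace E] {f : E → ℝ} (hf : Differentiable ℝ f) : IsGradientOf f (gradient f) :=
  fun z => (hf z).hasGradientAt.hasFDerivAt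

/-- Multiplication by `i` on `ℂⁿ`. -/
noncomputable def mulI (n : ℕ) : EuclideanSpace ℂ (Fin n) →L[ℝ] EuclideanSpace ℂ (Fin n) :=
  (Complex.I • ContinuousLinearMap.id ℂ (EuclideanSpace ℂ (Fin n))).restrictScalars ℝ

theorem isOrthogonalComplexStructure_mulI (n : ℕ) : IsOrthogonalComplexStructure (mulI n) where
  sq x := by simp [mulI, smul_smul]
  inner_map x y := by
    simp [mulI, PiLp.inner_apply, Complex.inner]

theorem one_lt_rank_euclideanSpace {n : ℕ} (hn : 1 ≤ n) :
    1 < Module.rank ℝ (EuclideanSpace ℂ (Fin n)) := by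
  have h : Module.finrank ℝ (EuclideanSpace ℂ (Fin n)) = 2 * n :=
    (finrank_real_of_complex _).trans (by rw [finrank_euclideanSpace_fin])
  rw [← Module.finrank_eq_rank, h]
  exact_mod_cast (by omega : 1 < 2 * n)

end complexSpace

end

/-- **Hofer–Zehnder–Struwe almost-existence theorem in `ℝ^{2n} = ℂⁿ`**: for a smooth
proper Hamiltonian `f`, almost every value `c` in the range of `f` is the energy of a
nonconstant periodic orbit of the Hamiltonian flow `γ' = i∇f(γ)`; i.e. the set of
values of `f` whose level carries no periodic orbit has Lebesgue measure zero. -/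
theorem hofer_zehnder_struwe_almost_existence (n : ℕ) (hn : 1 ≤ n)
    (f : EuclideanSpace ℂ (Fin n) → ℝ) (hf : ContDiff ℝ (⊤ : ℕ∞) f)
    (hproper : ∀ K : Set ℝ, IsCompact K → IsCompact (f ⁻¹' K)) :
    MeasureTheory.volume {c : ℝ | c ∈ Set.range f ∧
      ¬ ∃ γ : ℝ → EuclideanSpace ℂ (Fin n),
        (∀ t, HasDerivAt γ
          ((Complex.I • gradient f (γ t) : EuclideanSpace ℂ (Fin n))) t) ∧
        (∀ t, f (γ t) = c) ∧
        (∃ T > 0, ∀ t, γ (t + T) = γ t) ∧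
        (∃ t s, γ t ≠ γ s)} = 0 := by
  have h := ae_hasPeriodicOrbit_of_proper (one_lt_rank_euclideanSpace hn)
    (isOrthogonalComplexStructure_mulI n)
    (isGradientOf_gradient (hf.differentiable (by simp)))
    (contDiff_gradient (hf.of_le (WithTop.coe_le_coe.2 le_top))) hproper
  refine MeasureTheory.measure_mono_null ?_ (MeasureTheory.ae_iff.1 h)
  rintro c ⟨hc, hno⟩ hc'
  exact hno (hc' hc)
end

section
/- Let G = SL(2, ℝ) and let Γ ≤ G be a discrete subgroup such that the quotient space Γ\G (with the quotient topology) is compact. Then for every g ∈ G and every real T ≠ 0 one has g u_T g^{-1} ∉ Γ, where u_T is the unipotent matrix with rows (1, T) and (0, 1). Equivalently, the horocycle flow Γg ↦ Γ(g u_t) on Γ\G has no periodic points: Γ(g u_T) ≠ Γg for all g ∈ G and T ≠ 0. (This combines the fact that a cocompact discrete subgroup of SL(2,ℝ) contains no nontrivial unipotent element with the identification of periodic orbits of the homogeneous flow with conjugates of u_T lying in Γ; it is the mechanism behind the aperiodicity of the horocycle flow used in the paper.) -/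
/-- The topology on `SL(2, ℝ)` as a subspace of the `2×2` matrices. -/
instance : TopologicalSpace (Matrix.SpecialLinearGroup (Fin 2) ℝ) :=
  TopologicalSpace.induced
    (fun g => (g : Matrix (Fin 2) (Fin 2) ℝ)) inferInstance

/-- The one-parameter unipotent subgroup `u_T = [[1, T], [0, 1]]` of `SL(2, ℝ)`. -/
noncomputable def unipotentU (T : ℝ) : Matrix.SpecialLinearGroup (Fin 2) ℝ :=
  ⟨!![1, T; 0, 1], by simp [Matrix.det_fin_two_of]⟩

/-- A discrete subgroup `Γ` with compact quotient `Γ\G` has uniformly discrete conjugates: some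
neighbourhood of `1` meets every conjugate `y⁻¹ Γ y` only in `1`. -/
theorem Subgroup.exists_nhds_one_forall_conj_mem_imp_eq_one {G : Type*} [Group G]
    [TopologicalSpace G] [IsTopologicalGroup G] (Γ : Subgroup G) [DiscreteTopology Γ]
    [CompactSpace (Quotient (QuotientGroup.rightRel Γ))] :
    ∃ V ∈ nhds (1 : G), ∀ y : G, ∀ v ∈ V, y * v * y⁻¹ ∈ Γ → v = 1 := by
  suffices h : ∃ V ∈ nhds (1 : G), ∀ y : G,
      Quotient.mk (QuotientGroup.rightRel Γ) y ∈ Set.univ →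
        ∀ v ∈ V, y * v * y⁻¹ ∈ Γ → v = 1 by
    simpa using h
  refine isCompact_univ.induction_on
    (p := fun S => ∃ V ∈ nhds (1 : G), ∀ y : G, Quotient.mk (QuotientGroup.rightRel Γ) y ∈ S →
        ∀ v ∈ V, y * v * y⁻¹ ∈ Γ → v = 1)
    ⟨Set.univ, Filter.univ_mem, by simp⟩ ?_ ?_ ?_
  · rintro S S' hS ⟨V, hV, h⟩
    exact ⟨V, hV, fun y hy => h y (hS hy)⟩
  · rintro S S' ⟨V, hV, h⟩ ⟨V', hV', h'⟩
    exact ⟨V ∩ V', Filter.inter_mem hV hV', fun y hy v hv =>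
      hy.elim (fun hy => h y hy v hv.1) (fun hy => h' y hy v hv.2)⟩
  · rintro q -
    obtain ⟨x, rfl⟩ := Quotient.exists_rep q
    obtain ⟨W, hW, hWΓ⟩ : ∃ W ∈ nhds (1 : G), ∀ w ∈ W, w ∈ Γ → w = 1 := by
      have h1 : ({1} : Set Γ) ∈ nhds (1 : Γ) := by simp
      rw [nhds_subtype_eq_comap, Filter.mem_comap] at h1
      obtain ⟨W, hW, h⟩ := h1
      refine ⟨W, hW, fun w hw hwΓ => ?_⟩
      have : (⟨w, hwΓ⟩ : Γ) ∈ ({1} : Set Γ) := h hw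
      simpa [Subtype.ext_iff] using this
    have hc : Filter.Tendsto (fun p : G × G => p.1 * p.2 * p.1⁻¹)
        (nhds x ×ˢ nhds 1) (nhds 1) := by
      have : Continuous fun p : G × G => p.1 * p.2 * p.1⁻¹ := by fun_prop
      simpa [nhds_prod_eq] using this.tendsto (x, 1)
    obtain ⟨U, hU, V, hV, hUV⟩ := Filter.mem_prod_iff.1 (hc hW)
    have hopen : IsOpenMap (Quotient.mk (QuotientGroup.rightRel Γ)) :=
      isOpenMap_quotient_mk'_mul (Γ := Γ) (T := G)
    refine ⟨_, mem_nhdsWithin_of_mem_nhds (hopen.image_mem_nhds hU), V, hV, ?_⟩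
    rintro y ⟨z, hzU, hzy⟩ v hv hyv
    have hγ : y * z⁻¹ ∈ Γ := QuotientGroup.rightRel_apply.1 (Quotient.exact hzy)
    have hz : z * v * z⁻¹ ∈ Γ := by
      have := Γ.mul_mem (Γ.mul_mem (Γ.inv_mem hγ) hyv) hγ
      convert this using 1
      group
    exact conj_eq_one_iff.1 (hWΓ _ (hUV (Set.mk_mem_prod hzU hv)) hz)

/-- The frozen topology on `SL(2, ℝ)` is Mathlib's, so it is a group topology. -/
theorem isTopologicalGroup_specialLinearGroup_fin_two :
    IsTopologicalGroup (Matrix.SpecialLinearGroup (Fin 2) ℝ) :=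
  Matrix.SpecialLinearGroup.topologicalGroup

theorem continuous_unipotentU : Continuous unipotentU := by
  refine continuous_induced_rng.2 (continuous_matrix fun i j => ?_)
  fin_cases i <;> fin_cases j <;> simp [unipotentU] <;> fun_prop

theorem unipotentU_eq_one_iff {T : ℝ} : unipotentU T = 1 ↔ T = 0 := by
  refine ⟨fun h => ?_, ?_⟩
  · simpa [unipotentU] using
      congrArg (fun A : Matrix.SpecialLinearGroup (Fin 2) ℝ => A.1 0 1) h
  · rintro rfl
    ext i j
    fin_cases i <;> fin_cases j <;> simp [unipotentU]

/-- Conjugation by a diagonal matrix rescales the unipotent subgroup. -/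
theorem exists_conj_unipotentU_eq {s : ℝ} (hs : s ≠ 0) (T : ℝ) :
    ∃ a : Matrix.SpecialLinearGroup (Fin 2) ℝ,
      a * unipotentU (T * s ^ 2) * a⁻¹ = unipotentU T := by
  let a : Matrix.SpecialLinearGroup (Fin 2) ℝ :=
    ⟨!![s⁻¹, 0; 0, s], by simp [Matrix.det_fin_two_of, hs]⟩
  refine ⟨a, ?_⟩
  rw [mul_inv_eq_iff_eq_mul]
  ext i j
  rw [Matrix.SpecialLinearGroup.coe_mul, Matrix.SpecialLinearGroup.coe_mul]
  fin_cases i <;> fin_cases j <;> simp [a, unipotentU]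
  field_simp

/-- **Aperiodicity of the horocycle flow.** If `Γ` is a discrete subgroup of
`G = SL(2, ℝ)` with compact quotient `Γ\G`, then no nontrivial conjugate `g u_T g⁻¹`
(`T ≠ 0`) of the unipotent one-parameter subgroup lies in `Γ`; equivalently, the
horocycle flow `Γg ↦ Γ(g u_t)` on `Γ\G` has no periodic points. -/
theorem horocycle_flow_no_periodic_points
    (Γ : Subgroup (Matrix.SpecialLinearGroup (Fin 2) ℝ))
    [DiscreteTopology Γ]
    [CompactSpace (Quotient (QuotientGroup.rightRel Γ))] :
    ∀ (g : Matrix.SpecialLinearGroup (Fin 2) ℝ) (T : ℝ), T ≠ 0 →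
      g * unipotentU T * g⁻¹ ∉ Γ ∧
      Quotient.mk (QuotientGroup.rightRel Γ) (g * unipotentU T) ≠
        Quotient.mk (QuotientGroup.rightRel Γ) g := by
  intro g T hT
  have key : g * unipotentU T * g⁻¹ ∉ Γ := by
    intro hg
    have := isTopologicalGroup_specialLinearGroup_fin_two
    obtain ⟨V, hV, h⟩ := Γ.exists_nhds_one_forall_conj_mem_imp_eq_one
    have hlim : Filter.Tendsto (fun s : ℝ => unipotentU (T * s ^ 2)) (nhds 0) (nhds 1) := by
      have hc : Continuous fun s : ℝ => unipotentU (T * s ^ 2) :=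
        continuous_unipotentU.comp (by fun_prop)
      simpa [unipotentU_eq_one_iff.2] using hc.tendsto 0
    obtain ⟨s, hsV, hs⟩ := (((hlim.mono_left nhdsWithin_le_nhds).eventually hV).and
      (self_mem_nhdsWithin (a := (0 : ℝ)) (s := {0}ᶜ))).exists
    obtain ⟨a, ha⟩ := exists_conj_unipotentU_eq (s := s) hs T
    have h1 := h (g * a) _ hsV (by rw [← ha] at hg; simpa [mul_assoc] using hg)
    exact mul_ne_zero hT (pow_ne_zero 2 hs) (unipotentU_eq_one_iff.1 h1)
  refine ⟨key, fun h => key ?_⟩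
  simpa [mul_assoc] using
    Γ.inv_mem (QuotientGroup.rightRel_apply.1 (Quotient.exact h))
end
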